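/- Let Ω be an n-connected quadrature domain of finite area with C^∞ smooth boundary, let γ be a connected component of ∂Ω, let ω be the harmonic measure of γ, and let F'(z) = ∂ω/∂x(z) − i·∂ω/∂y(z) be the associated holomorphic function. Then F' is algebraic: there exists a nonzero polynomial P ∈ ℂ[X,Y] such that P(z, F'(z)) = 0 for all z ∈ Ω. -/

import Mathlib

open MeasureTheory Complex ComplexConjugate Metric Set

noncomputable section

/-- `f` belongs to the Bergman space `A²(Ω)`. -/
def BergmanFun (Ω : Set ℂ) (f : ℂ → ℂ) : Prop :=
  DifferentiableOn ℂ f Ω ∧ IntegrableOn (fun z => ‖f z‖ ^ 2) Ω volume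

/-- `Ω` is a finitely connected domain none of whose complementary components is a point. -/
def IsFinConnDomain (Ω : Set ℂ) : Prop :=
  IsOpen Ω ∧ IsConnected Ω ∧
  {C : Set ℂ | ∃ x ∈ Ωᶜ, C = connectedComponentIn Ωᶜ x}.Finite ∧
  ∀ x ∈ Ωᶜ, ¬ (connectedComponentIn Ωᶜ x).Subsingleton

/-- `Ω` is a quadrature domain. -/
def IsQuadratureDomain (Ω : Set ℂ) : Prop :=
  ∃ N : ℕ, 0 < N ∧ ∃ (w : Fin N → ℂ) (n : Fin N → ℕ) (c : Fin N → ℕ → ℂ),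
    (∀ j, w j ∈ Ω) ∧
    ∀ f : ℂ → ℂ, BergmanFun Ω f →
      (∫ z in Ω, f z) =
        ∑ j, ∑ k ∈ Finset.range (n j + 1), c j k * iteratedDerivWithin k f Ω (w j)

/-- `fa` is an Ahlfors map of `Ω` at `a`. -/
def IsAhlforsMap (Ω : Set ℂ) (a : ℂ) (fa : ℂ → ℂ) : Prop :=
  DifferentiableOn ℂ fa Ω ∧ (∀ z ∈ Ω, ‖fa z‖ < 1) ∧
  (deriv fa a).im = 0 ∧ 0 < (deriv fa a).re ∧
  ∀ g : ℂ → ℂ, DifferentiableOn ℂ g Ω → (∀ z ∈ Ω, ‖g z‖ < 1) →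
    ‖deriv g a‖ ≤ (deriv fa a).re

/-- `Ω` is bounded with `C^∞` smooth boundary consisting of finitely many disjoint
simple closed curves. -/
def HasSmoothBoundary (Ω : Set ℂ) : Prop :=
  Bornology.IsBounded Ω ∧
  ∃ (n : ℕ) (γ : Fin n → ℝ → ℂ),
    (∀ i, ContDiff ℝ (⊤ : ℕ∞) (γ i)) ∧
    (∀ i, Function.Periodic (γ i) (2 * Real.pi)) ∧
    (∀ i, InjOn (γ i) (Ico 0 (2 * Real.pi))) ∧
    (∀ i t, deriv (γ i) t ≠ 0) ∧
    (Pairwise fun i j => Disjoint (range (γ i)) (range (γ j))) ∧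
    frontier Ω = ⋃ i, range (γ i)

/-- Partial derivative in the `x`-direction of a real-valued function on `ℂ`. -/
def pdx (u : ℂ → ℝ) (z : ℂ) : ℝ := deriv (fun t : ℝ => u (z + (t : ℂ))) 0

/-- Partial derivative in the `y`-direction of a real-valued function on `ℂ`. -/
def pdy (u : ℂ → ℝ) (z : ℂ) : ℝ := deriv (fun t : ℝ => u (z + (t : ℂ) * Complex.I)) 0

/-- `f` is a proper holomorphic map of `Ω` onto the open unit disc. -/
def IsProperOntoDisc (Ω : Set ℂ) (f : ℂ → ℂ) : Prop :=
  DifferentiableOn ℂ f Ω ∧ f '' Ω = ball (0 : ℂ) 1 ∧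
  ∀ L : Set ℂ, L ⊆ ball (0 : ℂ) 1 → IsCompact L → IsCompact (Ω ∩ f ⁻¹' L)

/-- `g` is `(m, δ)`-close to the identity on `closure Ω`. -/
def CloseToId (Ω : Set ℂ) (m : ℕ) (δ : ℝ) (g : ℂ → ℂ) : Prop :=
  ∀ k ≤ m, ∀ z ∈ closure Ω, ‖iteratedFDeriv ℝ k (fun w => g w - w) z‖ ≤ δ

/-- `σ : [0,1] → ℂ` is a piecewise continuously differentiable curve. -/
def PiecewiseC1On01 (σ : ℝ → ℂ) : Prop :=
  ContinuousOn σ (Icc 0 1) ∧ ∃ s : Finset ℝ, ContDiffOn ℝ 1 σ (Icc (0 : ℝ) 1 \ s)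

/-- `Ω` is a generalized quadrature domain. -/
def IsGenQuadratureDomain (Ω : Set ℂ) : Prop :=
  ∃ (N M : ℕ) (w : Fin N → ℂ) (n : Fin N → ℕ) (c : Fin N → ℕ → ℂ)
    (b : Fin M → ℂ) (σ : Fin M → ℝ → ℂ),
    (∀ j, w j ∈ Ω) ∧
    (∀ m, PiecewiseC1On01 (σ m)) ∧
    (∀ m, ∀ t ∈ Icc (0 : ℝ) 1, σ m t ∈ Ω) ∧
    ∀ f : ℂ → ℂ, BergmanFun Ω f →
      (∫ z in Ω, f z) =
        (∑ j, ∑ k ∈ Finset.range (n j + 1), c j k * iteratedDerivWithin k f Ω (w j)) +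
        ∑ m, b m * ∫ t in (0 : ℝ)..1, f (σ m t) * deriv (σ m) t


section

open InnerProductSpace Topology Filter

lemma pdx_eq_fderiv {f : ℂ → ℝ} {z : ℂ} (hf : DifferentiableAt ℝ f z) :
    pdx f z = fderiv ℝ f z 1 := by
  rw [← hf.lineDeriv_eq_fderiv]
  simp [pdx, lineDeriv]

lemma pdy_eq_fderiv {f : ℂ → ℝ} {z : ℂ} (hf : DifferentiableAt ℝ f z) :
    pdy f z = fderiv ℝ f z I := by
  rw [← hf.lineDeriv_eq_fderiv]
  simp [pdy, lineDeriv]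

/-- A `C²` function whose iterated partial derivatives satisfy the Laplace equation is harmonic. -/
lemma harmonicOnNhd_of_pdx_pdy {Ω : Set ℂ} (ho : IsOpen Ω) {ω : ℂ → ℝ}
    (hωs : ContDiffOn ℝ 2 ω Ω)
    (hharm : ∀ z ∈ Ω, pdx (pdx ω) z + pdy (pdy ω) z = 0) : HarmonicOnNhd ω Ω := by
  intro z hz
  have hC : ∀ y ∈ Ω, ContDiffAt ℝ 2 ω y := fun y hy => hωs.contDiffAt (ho.mem_nhds hy)
  refine ⟨hC z hz, ?_⟩
  filter_upwards [ho.mem_nhds hz] with y hy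
  have hd : DifferentiableAt ℝ (fderiv ℝ ω) y :=
    ((hC y hy).fderiv_right (m := 1) (by norm_num)).differentiableAt (by norm_num)
  have key : ∀ v w : ℂ, fderiv ℝ (fun x => fderiv ℝ ω x v) y w = fderiv ℝ (fderiv ℝ ω) y w v := by
    intro v w
    rw [fderiv_clm_apply hd (by fun_prop)]
    simp
  have hx : pdx ω =ᶠ[𝓝 y] fun x => fderiv ℝ ω x 1 := by
    filter_upwards [ho.mem_nhds hy] with x hx
    exact pdx_eq_fderiv ((hC x hx).differentiableAt (by norm_num))
  have hy' : pdy ω =ᶠ[𝓝 y] fun x => fderiv ℝ ω x I := by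
    filter_upwards [ho.mem_nhds hy] with x hx
    exact pdy_eq_fderiv ((hC x hx).differentiableAt (by norm_num))
  have hd1 : ∀ v, DifferentiableAt ℝ (fun x => fderiv ℝ ω x v) y := fun v =>
    hd.clm_apply (by fun_prop)
  have h := hharm y hy
  rw [pdx_eq_fderiv ((hd1 1).congr_of_eventuallyEq hx), hx.fderiv_eq,
    pdy_eq_fderiv ((hd1 I).congr_of_eventuallyEq hy'), hy'.fderiv_eq, key, key] at h
  rw [laplacian_eq_iteratedFDeriv_complexPlane]
  simpa [iteratedFDeriv_two_apply] using h

/-- The complex gradient of the real part of a holomorphic function is its derivative. -/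
lemma pdx_sub_pdy_eq_deriv {ω : ℂ → ℝ} {F : ℂ → ℂ} {z : ℂ} (hF : DifferentiableAt ℂ F z)
    (h : ω =ᶠ[𝓝 z] fun y => (F y).re) :
    (pdx ω z : ℂ) - I * (pdy ω z : ℂ) = deriv F z := by
  have h1 : HasFDerivAt (fun y => (F y).re) (reCLM.comp (fderiv ℝ F z)) z :=
    reCLM.hasFDerivAt.comp z (hF.restrictScalars ℝ).hasFDerivAt
  have h2 := h1.congr_of_eventuallyEq h
  have h3 : ∀ v, fderiv ℝ F z v = v * deriv F z := by
    intro v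
    have := (hF.hasDerivAt.hasFDerivAt.restrictScalars ℝ).fderiv
    rw [this]; simp
  rw [pdx_eq_fderiv h2.differentiableAt, pdy_eq_fderiv h2.differentiableAt, h2.fderiv]
  simp only [ContinuousLinearMap.comp_apply, reCLM_apply, h3]
  apply Complex.ext <;> simp

/-- Gradient estimate for the real part of a holomorphic function. -/
lemma norm_deriv_le_of_abs_re_le {F : ℂ → ℂ} {z : ℂ} {r m : ℝ} (hr : 0 < r) (hm : 0 < m)
    (hF : DifferentiableOn ℂ F (ball z r)) (h : ∀ y ∈ ball z r, |(F y).re| ≤ m) :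
    ‖deriv F z‖ ≤ 16 * m / r := by
  have hzm : z ∈ ball z r := mem_ball_self hr
  have hsub : closedBall z (r / 2) ⊆ ball z r := closedBall_subset_ball (by linarith)
  have hFz : DifferentiableAt ℂ F z := hF.differentiableAt (isOpen_ball.mem_nhds hzm)
  have hd : HasDerivAt (fun y => Complex.exp (F y / m))
      (Complex.exp (F z / m) * (deriv F z / m)) z := (hFz.hasDerivAt.div_const _).cexp
  have h1 : ‖deriv (fun y => Complex.exp (F y / m)) z‖ ≤ Real.exp 1 / (r / 2) := by
    apply norm_deriv_le_of_forall_mem_sphere_norm_le (by positivity)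
    · apply DifferentiableOn.diffContOnCl
      rw [closure_ball _ (by positivity)]
      exact ((hF.mono hsub).div_const _).cexp
    · intro y hy
      rw [Complex.norm_exp]
      apply Real.exp_le_exp.2
      rw [div_ofReal_re, div_le_one hm]
      exact (abs_le.1 (h y (hsub (sphere_subset_closedBall hy)))).2
  rw [hd.deriv, norm_mul, norm_div, Complex.norm_exp, div_ofReal_re] at h1
  have h2 : Real.exp (-1) ≤ Real.exp ((F z).re / m) := by
    apply Real.exp_le_exp.2
    rw [le_div_iff₀ hm]
    have := (abs_le.1 (h z hzm)).1
    linarith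
  have h3 : ‖(m : ℂ)‖ = m := by simp [abs_of_pos hm]
  rw [h3] at h1
  have h4 : Real.exp (-1) * (‖deriv F z‖ / m) ≤ Real.exp 1 / (r / 2) :=
    (mul_le_mul_of_nonneg_right h2 (by positivity)).trans h1
  have h5 : ‖deriv F z‖ / m ≤ Real.exp 1 * (Real.exp 1 / (r / 2)) := by
    have := mul_le_mul_of_nonneg_left h4 (Real.exp_pos 1).le
    rwa [← mul_assoc, ← Real.exp_add, add_neg_cancel, Real.exp_zero, one_mul] at this
  have h6 : Real.exp 1 * Real.exp 1 ≤ 8 := by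
    have := Real.exp_one_lt_d9
    nlinarith [Real.exp_pos 1]
  rw [div_le_iff₀ hm] at h5
  refine h5.trans ?_
  have : Real.exp 1 * (Real.exp 1 / (r / 2)) * m = (Real.exp 1 * Real.exp 1) * (2 * m / r) := by
    field_simp
  rw [this]
  calc _ ≤ 8 * (2 * m / r) := by gcongr
    _ = _ := by ring

/-- `f` is locally the real part of a holomorphic function on `W`. -/
def LocallyReOn (f : ℂ → ℝ) (W : Set ℂ) : Prop :=
  ∀ z ∈ W, ∃ F : ℂ → ℂ, AnalyticAt ℂ F z ∧ f =ᶠ[𝓝 z] fun y => (F y).re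

lemma LocallyReOn.mono {f : ℂ → ℝ} {W V : Set ℂ} (h : LocallyReOn f W) (hV : V ⊆ W) :
    LocallyReOn f V := fun _ hz => h _ (hV hz)

lemma LocallyReOn.sub {f g : ℂ → ℝ} {W : Set ℂ} (hf : LocallyReOn f W) (hg : LocallyReOn g W) :
    LocallyReOn (fun z => f z - g z) W := by
  intro z hz
  obtain ⟨F, hF, h⟩ := hf z hz
  obtain ⟨G, hG, h'⟩ := hg z hz
  refine ⟨F - G, hF.sub hG, ?_⟩
  filter_upwards [h, h'] with y h1 h2
  simp [h1, h2]

lemma LocallyReOn.neg {f : ℂ → ℝ} {W : Set ℂ} (hf : LocallyReOn f W) :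
    LocallyReOn (fun z => - f z) W := by
  intro z hz
  obtain ⟨F, hF, h⟩ := hf z hz
  refine ⟨-F, hF.neg, ?_⟩
  filter_upwards [h] with y h1
  simp [h1]

lemma locallyReOn_re {F : ℂ → ℂ} {W : Set ℂ} (hW : IsOpen W) (hF : DifferentiableOn ℂ F W) :
    LocallyReOn (fun z => (F z).re) W := fun _ hz =>
  ⟨F, hF.analyticAt (hW.mem_nhds hz), Eventually.of_forall fun _ => rfl⟩

/-- The maximum principle for functions that are locally real parts of holomorphic functions. -/
lemma LocallyReOn.le_of_frontier_le {f : ℂ → ℝ} {W : Set ℂ} {m : ℝ} (ho : IsOpen W)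
    (hb : Bornology.IsBounded W) (hf : LocallyReOn f W) (hc : ContinuousOn f (closure W))
    (hm : ∀ z ∈ frontier W, f z ≤ m) : ∀ z ∈ W, f z ≤ m := by
  intro z hz
  have hK : IsCompact (closure W) := hb.isCompact_closure
  obtain ⟨z₀, hz₀, hmax⟩ := hK.exists_isMaxOn ⟨z, subset_closure hz⟩ hc
  by_contra! hlt
  have hlt0 : m < f z₀ := hlt.trans_le (hmax (subset_closure hz))
  have hA : IsCompact (closure W ∩ f ⁻¹' {f z₀}) :=
    hK.of_isClosed_subset (hc.preimage_isClosed_of_isClosed isClosed_closure isClosed_singleton)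
      inter_subset_left
  obtain ⟨z₁, hz₁, hre⟩ := hA.exists_isMaxOn ⟨z₀, hz₀, rfl⟩ continuous_re.continuousOn
  have hz₁f : f z₁ = f z₀ := hz₁.2
  have hz₁W : z₁ ∈ W := by
    by_contra hn
    have := hm z₁ ⟨hz₁.1, by rwa [ho.interior_eq]⟩
    linarith
  obtain ⟨F, hF, hfF⟩ := hf z₁ hz₁W
  have hloc : IsLocalMax (norm ∘ fun y => Complex.exp (F y)) z₁ := by
    filter_upwards [hfF, ho.mem_nhds hz₁W] with y hy hyW
    simp only [Function.comp, Complex.norm_exp, ← hy, ← hfF.self_of_nhds]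
    rw [hz₁f]
    exact Real.exp_le_exp.2 (hmax (subset_closure hyW))
  have hd : ∀ᶠ y in 𝓝 z₁, DifferentiableAt ℂ (fun y => Complex.exp (F y)) y := by
    filter_upwards [hF.eventually_analyticAt] with y hy
    exact hy.differentiableAt.cexp
  have hev := norm_eventually_eq_of_isLocalMax hd hloc
  have hev2 : ∀ᶠ y in 𝓝 z₁, y ∈ closure W ∩ f ⁻¹' {f z₀} := by
    filter_upwards [hev, hfF, ho.mem_nhds hz₁W] with y h1 h2 h3
    refine ⟨subset_closure h3, ?_⟩
    rw [Complex.norm_exp, Complex.norm_exp, Real.exp_eq_exp, ← h2] at h1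
    exact (h1.trans hfF.self_of_nhds.symm).trans hz₁f
  have hcont : Tendsto (fun t : ℝ => z₁ + (t : ℂ)) (𝓝[>] 0) (𝓝 z₁) := by
    have : ContinuousAt (fun t : ℝ => z₁ + (t : ℂ)) 0 := by fun_prop
    have h := this.tendsto
    simp only [ofReal_zero, add_zero] at h
    exact h.mono_left nhdsWithin_le_nhds
  obtain ⟨t, ht, htpos⟩ := ((hcont.eventually hev2).and self_mem_nhdsWithin).exists
  have := hre ht
  simp at this
  exact absurd this (not_le.2 htpos)

lemma _root_.InnerProductSpace.HarmonicOnNhd.locallyReOn {ω : ℂ → ℝ} {Ω : Set ℂ} (ho : IsOpen Ω)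
    (h : HarmonicOnNhd ω Ω) : LocallyReOn ω Ω := by
  intro z hz
  obtain ⟨R, hR, hsub⟩ := Metric.isOpen_iff.1 ho z hz
  obtain ⟨F, hF, hE⟩ := HarmonicOnNhd.exists_analyticOnNhd_ball_re_eq
    (f := ω) (z := z) (R := R) fun y hy => h y (hsub hy)
  exact ⟨F, hF z (mem_ball_self hR), (hE.eventuallyEq_of_mem (ball_mem_nhds z hR)).symm⟩

end

section

open InnerProductSpace Topology Filter

/-- The discs of radius `ρ` tangent to `frontier Ω` at `p`, with unit tangent vector `T`, do not
meet `frontier Ω`, and the disc on the right of `T` does not meet `Ω`. -/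
structure TangentBalls (Ω : Set ℂ) (ρ : ℝ) (p T : ℂ) : Prop where
  norm_eq_one : ‖T‖ = 1
  frontier_le : ∀ q ∈ frontier Ω, 2 * ρ * |((q - p) * conj T).im| ≤ ‖q - p‖ ^ 2
  le : ∀ z ∈ Ω, -(2 * ρ * ((z - p) * conj T).im) ≤ ‖z - p‖ ^ 2

lemma TangentBalls.le_of_mem_closure {Ω : Set ℂ} {ρ : ℝ} {p T : ℂ} (h : TangentBalls Ω ρ p T) :
    ∀ z ∈ closure Ω, -(2 * ρ * ((z - p) * conj T).im) ≤ ‖z - p‖ ^ 2 := by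
  intro z hz
  have hcl : IsClosed {z : ℂ | -(2 * ρ * ((z - p) * conj T).im) ≤ ‖z - p‖ ^ 2} :=
    isClosed_le (by fun_prop) (by fun_prop)
  exact closure_minimal h.le hcl hz

/-- A holomorphic quadratic barrier at a boundary point with tangent discs. -/
def barrier (r : ℝ) (w : ℂ) : ℂ := w ^ 2 / r ^ 2 - 2 * I * w / r

lemma barrier_re (r : ℝ) (w : ℂ) :
    (barrier r w).re = (w.re ^ 2 - w.im ^ 2) / r ^ 2 + 2 * w.im / r := by
  have h1 : w ^ 2 / (r : ℂ) ^ 2 = w ^ 2 / ((r ^ 2 : ℝ) : ℂ) := by norm_cast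
  rw [barrier, h1, sub_re, div_ofReal_re, div_ofReal_re]
  simp [pow_two]
  ring

lemma le_barrier_re {ρ r : ℝ} {w : ℂ} (hr : 0 < r) (hrρ : 4 * r ≤ ρ) (hw : ‖w‖ ≤ r)
    (h : -(2 * ρ * w.im) ≤ ‖w‖ ^ 2) : ‖w‖ ^ 2 / (2 * r ^ 2) ≤ (barrier r w).re := by
  have hn : ‖w‖ ^ 2 = w.re ^ 2 + w.im ^ 2 := by
    rw [Complex.sq_norm, normSq_apply]; ring
  have hn2 : ‖w‖ ^ 2 ≤ r ^ 2 := by gcongr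
  have e : (barrier r w).re = (w.re ^ 2 - w.im ^ 2 + 2 * w.im * r) / r ^ 2 := by
    rw [barrier_re]; field_simp
  rw [e, div_le_div_iff₀ (by positivity) (by positivity)]
  have : ‖w‖ ^ 2 ≤ 2 * (w.re ^ 2 - w.im ^ 2 + 2 * w.im * r) := by
    have him : |w.im| ≤ r := (abs_im_le_norm w).trans hw
    obtain ⟨h1, h2⟩ := abs_le.1 him
    rw [hn] at h ⊢ 
    rcases le_total 0 w.im with h0 | h0
    · nlinarith
    · have h3 : -(8 * r * w.im) ≤ w.re ^ 2 + w.im ^ 2 := by nlinarith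
      nlinarith
  nlinarith [sq_nonneg r]

lemma barrier_re_le {r : ℝ} {w : ℂ} (hr : 0 < r) (hw : ‖w‖ ≤ r) :
    (barrier r w).re ≤ 3 * ‖w‖ / r := by
  have hn : ‖w‖ ^ 2 = w.re ^ 2 + w.im ^ 2 := by
    rw [Complex.sq_norm, normSq_apply]; ring
  have e : (barrier r w).re = (w.re ^ 2 - w.im ^ 2 + 2 * w.im * r) / r ^ 2 := by
    rw [barrier_re]; field_simp
  rw [e, div_le_div_iff₀ (by positivity) (by positivity)]
  have h1 : w.im ≤ ‖w‖ := im_le_norm w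
  have : (w.re ^ 2 - w.im ^ 2 + 2 * w.im * r) ≤ 3 * ‖w‖ * r := by
    nlinarith [norm_nonneg w, sq_nonneg w.im]
  nlinarith

lemma norm_mul_conj_of_norm_eq_one {T : ℂ} (hT : ‖T‖ = 1) (w : ℂ) : ‖w * conj T‖ = ‖w‖ := by
  simp [hT]

lemma conj_mul_self_of_norm_eq_one {T : ℂ} (hT : ‖T‖ = 1) : conj T * T = 1 := by
  rw [mul_comm, mul_conj, normSq_eq_norm_sq, hT]; simp

lemma frontier_inter_ball_subset {Ω : Set ℂ} {p : ℂ} {r : ℝ} (ho : IsOpen Ω) {z : ℂ}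
    (hz : z ∈ frontier (Ω ∩ ball p r)) :
    z ∈ closure Ω ∧ ‖z - p‖ ≤ r ∧ (z ∈ frontier Ω ∨ ‖z - p‖ = r) := by
  have h1 : z ∈ closure Ω := closure_mono inter_subset_left hz.1
  have h2 : z ∈ closedBall p r :=
    closure_ball_subset_closedBall (closure_mono inter_subset_right hz.1)
  have h2' : ‖z - p‖ ≤ r := by simpa [dist_eq_norm] using h2
  refine ⟨h1, h2', ?_⟩
  rw [frontier, (ho.inter isOpen_ball).interior_eq] at hz
  by_cases hzΩ : z ∈ Ω
  · right
    have : ¬ ‖z - p‖ < r := fun hlt => hz.2 ⟨hzΩ, by simpa [dist_eq_norm] using hlt⟩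
    exact le_antisymm h2' (not_lt.1 this)
  · left
    exact ⟨h1, by rwa [ho.interior_eq]⟩

lemma closure_inter_ball_subset {Ω : Set ℂ} {p : ℂ} {r : ℝ} :
    closure (Ω ∩ ball p r) ⊆ closure Ω ∩ closedBall p r := fun _ hz =>
  ⟨closure_mono inter_subset_left hz,
    closure_ball_subset_closedBall (closure_mono inter_subset_right hz)⟩

/-- Two-constants estimate near a boundary point, for a holomorphic function vanishing
quadratically along the boundary. -/
lemma TangentBalls.norm_le_mul_exp {Ω : Set ℂ} {ρ r B : ℝ} {p T : ℂ} (ho : IsOpen Ω)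
    (h : TangentBalls Ω ρ p T) (hr : 0 < r) (hrρ : 4 * r ≤ ρ) {g : ℂ → ℂ}
    (hd : DifferentiableOn ℂ g (Ω ∩ ball p r))
    (hc : ContinuousOn g (closure Ω ∩ closedBall p r))
    (hB : ∀ z ∈ closure Ω ∩ closedBall p r, ‖g z‖ ≤ B)
    (hg : ∀ z ∈ frontier Ω ∩ closedBall p r, ρ * ‖g z‖ ≤ ‖z - p‖ ^ 2)
    (hrB : r ^ 2 / ρ ≤ B) :
    ∀ z ∈ Ω ∩ ball p r, ‖g z‖ ≤
      (r ^ 2 / ρ) * Real.exp (2 * Real.log (B * ρ / r ^ 2) * (barrier r ((z - p) * conj T)).re) := by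
  have hρ : 0 < ρ := by linarith
  have hB0 : 0 < B := lt_of_lt_of_le (by positivity) hrB
  set l : ℝ := Real.log (B * ρ / r ^ 2) with hl
  have hl0 : 0 ≤ l := by
    apply Real.log_nonneg
    rw [le_div_iff₀ (by positivity)]
    rw [div_le_iff₀ hρ] at hrB
    linarith
  have hexpl : Real.exp (-l) = r ^ 2 / (B * ρ) := by
    rw [Real.exp_neg, hl, Real.exp_log (by positivity), inv_div]
  have hH : Differentiable ℂ fun z => Complex.exp (-(2 * l * barrier r ((z - p) * conj T))) := by
    unfold barrier
    fun_prop
  have hnorm : ∀ z, ‖g z * Complex.exp (-(2 * l * barrier r ((z - p) * conj T)))‖ =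
      ‖g z‖ * Real.exp (-(2 * l * (barrier r ((z - p) * conj T)).re)) := by
    intro z
    rw [norm_mul, Complex.norm_exp]
    congr 2
    simp
  have hmax : ∀ z ∈ closure (Ω ∩ ball p r),
      ‖g z * Complex.exp (-(2 * l * barrier r ((z - p) * conj T)))‖ ≤ r ^ 2 / ρ := by
    intro z hz
    refine norm_le_of_forall_mem_frontier_norm_le (isBounded_ball.subset inter_subset_right)
      (f := fun z => g z * Complex.exp (-(2 * l * barrier r ((z - p) * conj T))))
      ⟨hd.mul hH.differentiableOn, (hc.mono closure_inter_ball_subset).mul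
        hH.continuous.continuousOn⟩ ?_ hz
    intro q hq
    obtain ⟨hq1, hq2, hq3⟩ := frontier_inter_ball_subset ho hq
    have hqb : q ∈ closedBall p r := by simpa [dist_eq_norm] using hq2
    have hnq := norm_mul_conj_of_norm_eq_one h.norm_eq_one (q - p)
    have hlow := le_barrier_re (ρ := ρ) (w := (q - p) * conj T) hr hrρ (by rwa [hnq])
      (by rw [hnq]; exact h.le_of_mem_closure q hq1)
    rw [hnq] at hlow
    rw [hnorm]
    rcases hq3 with hq3 | hq3
    · have h1 := hg q ⟨hq3, hqb⟩
      have h2 : Real.exp (-(2 * l * (barrier r ((q - p) * conj T)).re)) ≤ 1 := by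
        apply Real.exp_le_one_iff.2
        have : 0 ≤ (barrier r ((q - p) * conj T)).re := le_trans (by positivity) hlow
        have := mul_nonneg (mul_nonneg zero_le_two hl0) this
        linarith
      calc _ ≤ ‖g q‖ * 1 := by gcongr
        _ ≤ r ^ 2 / ρ := by
          rw [le_div_iff₀ hρ]
          nlinarith [norm_nonneg (q - p)]
    · rw [hq3] at hlow
      have h3 : (1 : ℝ) / 2 ≤ (barrier r ((q - p) * conj T)).re := by
        refine le_trans (le_of_eq ?_) hlow
        field_simp
      have h2 : Real.exp (-(2 * l * (barrier r ((q - p) * conj T)).re)) ≤ r ^ 2 / (B * ρ) := by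
        rw [← hexpl]
        apply Real.exp_le_exp.2
        nlinarith
      calc _ ≤ B * (r ^ 2 / (B * ρ)) := by
            gcongr
            exact hB q ⟨hq1, hqb⟩
        _ = r ^ 2 / ρ := by field_simp
  intro z hz
  have h1 := hmax z (subset_closure hz)
  rw [hnorm, Real.exp_neg, ← div_eq_mul_inv, div_le_iff₀ (Real.exp_pos _)] at h1
  exact h1

/-- Boundary behaviour of the derivative of a function which agrees with complex conjugation on
the boundary. -/
lemma TangentBalls.norm_deriv_sub_pow_le {Ω : Set ℂ} {ρ r₀ B : ℝ} {p T : ℂ} (ho : IsOpen Ω)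
    (h : TangentBalls Ω ρ p T) (hrρ : 4 * r₀ ≤ ρ) {S : ℂ → ℂ}
    (hd : DifferentiableOn ℂ S (Ω ∩ ball p r₀))
    (hc : ContinuousOn S (closure Ω ∩ closedBall p r₀))
    (hB : ∀ z ∈ closure Ω ∩ closedBall p r₀, ‖S z - conj z‖ ≤ B)
    (hS : ∀ z ∈ frontier Ω ∩ closedBall p r₀, S z = conj z)
    {z : ℂ} {d : ℝ} (hd0 : 0 < d) (hdr : 48 * d ≤ r₀) (hzd : ‖z - p‖ ≤ d) (hball : ball z d ⊆ Ω) :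
    ‖deriv S z - conj T ^ 2‖ ^ 4 ≤ 16 * 2304 ^ 3 * (B + 3 * r₀) / ρ ^ 3 * d ^ 2 := by
  have hr₀ : 0 < r₀ := by linarith
  have hρ : 0 < ρ := by linarith
  have hTT := conj_mul_self_of_norm_eq_one h.norm_eq_one
  have hpB : 0 ≤ B := (norm_nonneg _).trans (hB z
    ⟨subset_closure (hball (mem_ball_self hd0)), by rw [mem_closedBall, dist_eq_norm]; linarith⟩)
  set g : ℂ → ℂ := fun z => S z - conj p - conj T ^ 2 * (z - p) with hg
  have hgd : DifferentiableOn ℂ g (Ω ∩ ball p r₀) := by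
    refine (hd.sub_const _).sub ?_
    fun_prop
  have hgc : ContinuousOn g (closure Ω ∩ closedBall p r₀) := by
    refine (hc.sub continuousOn_const).sub ?_
    fun_prop
  have hgB : ∀ z ∈ closure Ω ∩ closedBall p r₀, ‖g z‖ ≤ B + 3 * r₀ := by
    intro z hz
    have h1 : ‖z - p‖ ≤ r₀ := by simpa [dist_eq_norm] using hz.2
    have e : g z = (S z - conj z) + (conj (z - p) - conj T ^ 2 * (z - p)) := by
      simp only [hg, map_sub]; ring
    rw [e]
    have h2 : ‖conj (z - p)‖ = ‖z - p‖ := RCLike.norm_conj _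
    have h3 : ‖conj T ^ 2 * (z - p)‖ = ‖z - p‖ := by
      rw [norm_mul, norm_pow, RCLike.norm_conj, h.norm_eq_one]; simp
    calc _ ≤ ‖S z - conj z‖ + (‖conj (z - p)‖ + ‖conj T ^ 2 * (z - p)‖) :=
          (norm_add_le _ _).trans (by gcongr; exact norm_sub_le _ _)
      _ ≤ B + (r₀ + r₀) := by rw [h2, h3]; gcongr; exact hB z hz
      _ ≤ _ := by linarith
  have hgf : ∀ z ∈ frontier Ω ∩ closedBall p r₀, ρ * ‖g z‖ ≤ ‖z - p‖ ^ 2 := by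
    intro q hq
    have e : g q = conj T * (conj ((q - p) * conj T) - (q - p) * conj T) := by
      simp only [hg, hS q hq, map_sub, map_mul, conj_conj]
      linear_combination (conj p - conj q) * hTT
    have e2 : ‖g q‖ = 2 * |((q - p) * conj T).im| := by
      rw [e, norm_mul, RCLike.norm_conj, h.norm_eq_one, one_mul, norm_sub_rev, sub_conj, norm_mul, norm_I,
        mul_one, norm_real, Real.norm_eq_abs, abs_mul, abs_two]
    have := h.frontier_le q hq.1
    rw [e2]; linarith
  set r : ℝ := 48 * d with hr
  have hr0 : 0 < r := by positivity
  have hsub1 : Ω ∩ ball p r ⊆ Ω ∩ ball p r₀ := inter_subset_inter_right _ (ball_subset_ball hdr)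
  have hsub2 : closure Ω ∩ closedBall p r ⊆ closure Ω ∩ closedBall p r₀ :=
    inter_subset_inter_right _ (closedBall_subset_closedBall hdr)
  have hsub3 : frontier Ω ∩ closedBall p r ⊆ frontier Ω ∩ closedBall p r₀ :=
    inter_subset_inter_right _ (closedBall_subset_closedBall hdr)
  have hrB : r ^ 2 / ρ ≤ B + 3 * r₀ := by
    rw [div_le_iff₀ hρ]
    nlinarith
  have key := h.norm_le_mul_exp ho hr0 (by linarith) (hgd.mono hsub1) (hgc.mono hsub2)
    (fun z hz => hgB z (hsub2 hz)) (fun z hz => hgf z (hsub3 hz)) hrB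
  set A : ℝ := (B + 3 * r₀) * ρ / r ^ 2 with hA
  have hA1 : 1 ≤ A := by
    rw [hA, le_div_iff₀ (by positivity)]
    rw [div_le_iff₀ hρ] at hrB
    linarith
  have hl0 : 0 ≤ Real.log A := Real.log_nonneg hA1
  have hgz : ∀ y ∈ closedBall z (d / 2), ‖g y‖ ≤ r ^ 2 / ρ * Real.exp (Real.log A / 4) := by
    intro y hy
    have hy1 : ‖y - z‖ ≤ d / 2 := by simpa [dist_eq_norm] using hy
    have hyp : ‖y - p‖ ≤ 2 * d := by
      have := norm_add_le (y - z) (z - p)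
      rw [sub_add_sub_cancel] at this
      linarith
    have hyΩ : y ∈ Ω := hball (closedBall_subset_ball (by linarith) hy)
    have hyb : y ∈ ball p r := by
      rw [mem_ball, dist_eq_norm]; linarith
    refine (key y ⟨hyΩ, hyb⟩).trans ?_
    gcongr
    have hb := barrier_re_le (w := (y - p) * conj T) hr0
      (by rw [norm_mul_conj_of_norm_eq_one h.norm_eq_one]; linarith)
    rw [norm_mul_conj_of_norm_eq_one h.norm_eq_one] at hb
    have hb2 : (barrier r ((y - p) * conj T)).re ≤ 1 / 8 := by
      refine hb.trans ?_
      rw [div_le_div_iff₀ hr0 (by norm_num)]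
      linarith
    nlinarith
  have hzΩ : z ∈ Ω ∩ ball p r₀ := by
    refine ⟨hball (mem_ball_self hd0), ?_⟩
    rw [mem_ball, dist_eq_norm]; linarith
  have hSz : DifferentiableAt ℂ S z := hd.differentiableAt ((ho.inter isOpen_ball).mem_nhds hzΩ)
  have hderiv : deriv g z = deriv S z - conj T ^ 2 := by
    have h1 : HasDerivAt g (deriv S z - conj T ^ 2 * 1) z :=
      (hSz.hasDerivAt.sub_const _).sub (((hasDerivAt_id z).sub_const p).const_mul _)
    rw [h1.deriv, mul_one]
  have hcauchy : ‖deriv g z‖ ≤ (r ^ 2 / ρ * Real.exp (Real.log A / 4)) / (d / 2) := by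
    apply norm_deriv_le_of_forall_mem_sphere_norm_le (by positivity)
    · apply DifferentiableOn.diffContOnCl
      rw [closure_ball _ (by positivity)]
      refine hgd.mono fun y hy => ⟨hball (closedBall_subset_ball (by linarith) hy), ?_⟩
      have hy1 : ‖y - z‖ ≤ d / 2 := by simpa [dist_eq_norm] using hy
      have := norm_add_le (y - z) (z - p)
      rw [sub_add_sub_cancel] at this
      rw [mem_ball, dist_eq_norm]; linarith
    · exact fun y hy => hgz y (sphere_subset_closedBall hy)
  rw [← hderiv]
  calc ‖deriv g z‖ ^ 4 ≤ ((r ^ 2 / ρ * Real.exp (Real.log A / 4)) / (d / 2)) ^ 4 := by gcongr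
    _ = (r ^ 2 / ρ / (d / 2)) ^ 4 * Real.exp (Real.log A / 4) ^ 4 := by ring
    _ = (r ^ 2 / ρ / (d / 2)) ^ 4 * A := by
      rw [← Real.exp_nat_mul]
      congr 1
      rw [show ((4 : ℕ) : ℝ) * (Real.log A / 4) = Real.log A by push_cast; ring]
      exact Real.exp_log (by linarith)
    _ = _ := by
      rw [hA, hr]
      field_simp
      norm_num

end

section

open InnerProductSpace Topology Filter

lemma mem_ball_I_mul_iff {ρ : ℝ} {w : ℂ} (hρ : 0 < ρ) :
    w ∈ ball (I * ρ) ρ ↔ ‖w‖ ^ 2 < 2 * ρ * w.im := by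
  rw [mem_ball, dist_eq_norm, ← abs_norm, ← abs_of_pos hρ, ← sq_lt_sq, abs_of_pos hρ,
    Complex.sq_norm, Complex.sq_norm, normSq_apply, normSq_apply]
  simp
  constructor <;> intro h <;> nlinarith

/-- A harmonic barrier of homogeneity `3 / 2` in the first quadrant. -/
def quadrantBarrier (w : ℂ) : ℂ :=
  Complex.exp (-(3 * Real.pi / 8 * I)) * w ^ (3 / 2 : ℂ)

lemma quadrantBarrier_re_le (w : ℂ) : (quadrantBarrier w).re ≤ √‖w‖ ^ 3 := by
  refine (re_le_norm _).trans ?_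
  have h1 : ‖Complex.exp (-(3 * Real.pi / 8 * I))‖ = 1 := by
    have := Complex.norm_exp_ofReal_mul_I (-(3 * Real.pi / 8))
    rw [← this]; congr 2; push_cast; ring
  rw [quadrantBarrier, norm_mul, h1, one_mul]
  rcases eq_or_ne w 0 with rfl | hw
  · simp
  · have := norm_cpow_of_ne_zero hw (3 / 2 : ℂ)
    have h2 : (3 / 2 : ℂ) = ((3 / 2 : ℝ) : ℂ) := by push_cast; rfl
    rw [this, h2, ofReal_im, mul_zero, Real.exp_zero, div_one, ofReal_re, Real.sqrt_eq_rpow,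
      ← Real.rpow_natCast, ← Real.rpow_mul (norm_nonneg _)]
    norm_num

lemma le_quadrantBarrier_re {w : ℂ} (hre : 0 ≤ w.re) (him : 0 ≤ w.im) :
    Real.cos (3 * Real.pi / 8) * √‖w‖ ^ 3 ≤ (quadrantBarrier w).re := by
  rcases eq_or_ne w 0 with rfl | hw
  · simp [quadrantBarrier]
  have h1 : quadrantBarrier w = Complex.exp
      ((3 / 2 * Real.log ‖w‖ : ℝ) + ((3 / 2 * w.arg - 3 * Real.pi / 8 : ℝ) : ℂ) * I) := by
    rw [quadrantBarrier, cpow_def_of_ne_zero hw, ← Complex.exp_add]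
    congr 1
    rw [← re_add_im (log w), log_re, log_im]
    push_cast
    ring
  have h2 : √‖w‖ ^ 3 = Real.exp (3 / 2 * Real.log ‖w‖) := by
    rw [mul_comm, ← Real.rpow_def_of_pos (norm_pos_iff.2 hw), Real.sqrt_eq_rpow,
      ← Real.rpow_natCast, ← Real.rpow_mul (norm_nonneg _)]
    norm_num
  rw [h1, Complex.exp_re, h2, mul_comm]
  have e1 : (((3 / 2 * Real.log ‖w‖ : ℝ) : ℂ) +
      ((3 / 2 * w.arg - 3 * Real.pi / 8 : ℝ) : ℂ) * I).re = 3 / 2 * Real.log ‖w‖ := by simp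
  have e2 : (((3 / 2 * Real.log ‖w‖ : ℝ) : ℂ) +
      ((3 / 2 * w.arg - 3 * Real.pi / 8 : ℝ) : ℂ) * I).im = 3 / 2 * w.arg - 3 * Real.pi / 8 := by
    simp
  rw [e1, e2]
  gcongr
  rw [← Real.cos_abs (3 / 2 * w.arg - 3 * Real.pi / 8)]
  have ha0 : 0 ≤ w.arg := arg_nonneg_iff.2 him
  have ha1 : w.arg ≤ Real.pi / 2 := arg_le_pi_div_two_iff.2 (Or.inl hre)
  apply Real.cos_le_cos_of_nonneg_of_le_pi (abs_nonneg _)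
  · linarith [Real.pi_pos]
  · rw [abs_le]; constructor <;> linarith

/-- A function on a disc tangent to the real axis at `0`, holomorphic and with real part
`O(Im w)` up to a constant, has small horizontal derivative of its real part near `0`. -/
lemma abs_re_deriv_le_sqrt {F : ℂ → ℂ} {ρ r L c d : ℝ} (hr : 0 < r) (hrρ : r < ρ) (hL : 0 < L)
    (hF : DifferentiableOn ℂ F (ball (I * ρ) ρ))
    (hb : ∀ w : ℂ, ‖w‖ ^ 2 ≤ 2 * r * w.im → w ≠ 0 → |(F w).re - c| ≤ 2 * L * w.im)
    (hd : 0 < d) (hdr : 4 * d ≤ r) :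
    |(deriv F (I * d)).re| ≤
      64 * L * √(2 * r) / (r * Real.cos (3 * Real.pi / 8)) * √(2 * d) := by
  have hρ : 0 < ρ := hr.trans hrρ
  have hcos : 0 < Real.cos (3 * Real.pi / 8) := Real.cos_pos_of_mem_Ioo
    ⟨by linarith [Real.pi_pos], by linarith [Real.pi_pos]⟩
  set A : ℝ := 2 * L * √(2 * r) / (r * Real.cos (3 * Real.pi / 8)) with hA
  have hA0 : 0 < A := by positivity
  set G : ℂ → ℂ := fun w => F w - conj (F (-conj w)) with hG
  have hrefl : ∀ {s : ℝ} {w : ℂ}, ‖w‖ ^ 2 ≤ 2 * s * w.im → ‖-conj w‖ ^ 2 ≤ 2 * s * (-conj w).im := by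
    intro s w h; simpa using h
  have hGd : ∀ w ∈ ball (I * ρ) ρ, HasDerivAt G (deriv F w + conj (deriv F (-conj w))) w := by
    intro w hw
    have hw' : -conj w ∈ ball (I * ρ) ρ := by
      rw [mem_ball_I_mul_iff hρ] at hw ⊢; simpa using hw
    have h1 := (hF.differentiableAt (isOpen_ball.mem_nhds hw)).hasDerivAt
    have h2 := (hF.differentiableAt (isOpen_ball.mem_nhds hw')).hasDerivAt
    have h3 : HasDerivAt (fun w => F (-w)) (-deriv F (-conj w)) (conj w) := by
      have := h2.scomp (conj w) (hasDerivAt_neg (conj w))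
      simpa [Function.comp_def] using this
    have h4 := h3.conj_conj
    simp only [conj_conj, map_neg] at h4
    have := h1.sub h4
    rw [sub_neg_eq_add] at this
    exact this
  have hGdiff : DifferentiableOn ℂ G (ball (I * ρ) ρ) := fun w hw =>
    (hGd w hw).differentiableAt.differentiableWithinAt
  have hlens : ∀ w : ℂ, ‖w‖ ^ 2 ≤ 2 * r * w.im → w ≠ 0 → w ∈ ball (I * ρ) ρ := by
    intro w hw hw0
    rw [mem_ball_I_mul_iff hρ]
    have : 0 < w.im := by
      have : 0 < ‖w‖ ^ 2 := by positivity
      nlinarith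
    nlinarith
  have hGb : ∀ w : ℂ, ‖w‖ ^ 2 ≤ 2 * r * w.im → |(G w).re| ≤ 4 * L * w.im := by
    intro w hw
    rcases eq_or_ne w 0 with rfl | hw0
    · simp [hG]
    · have h1 := hb w hw hw0
      have h2 := hb (-conj w) (hrefl hw) (by simpa using hw0)
      have : (G w).re = ((F w).re - c) - ((F (-conj w)).re - c) := by simp [hG]
      rw [this]
      refine (abs_sub _ _).trans ?_
      simp only [neg_im, conj_im, neg_neg] at h2
      linarith
  set W : Set ℂ := ball (I * r) r ∩ {w | 0 < w.re} with hW
  have hWo : IsOpen W := isOpen_ball.inter (isOpen_lt continuous_const continuous_re)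
  have hWcl : ∀ w ∈ closure W, ‖w‖ ^ 2 ≤ 2 * r * w.im ∧ 0 ≤ w.re := by
    intro w hw
    have h1 : IsClosed {w : ℂ | ‖w‖ ^ 2 ≤ 2 * r * w.im} := isClosed_le (by fun_prop) (by fun_prop)
    have h2 : IsClosed {w : ℂ | 0 ≤ w.re} := isClosed_le (by fun_prop) (by fun_prop)
    have hcl : IsClosed ({w : ℂ | ‖w‖ ^ 2 ≤ 2 * r * w.im} ∩ {w : ℂ | 0 ≤ w.re}) := h1.inter h2
    refine closure_minimal (fun w hw => ?_) hcl hw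
    have h3 : 0 < w.re := hw.2
    exact ⟨((mem_ball_I_mul_iff hr).1 hw.1).le, h3.le⟩
  have hWne : ∀ w ∈ W, ‖w‖ ^ 2 ≤ 2 * r * w.im ∧ w ≠ 0 ∧ 0 < w.re := by
    intro w hw
    refine ⟨(hWcl w (subset_closure hw)).1, ?_, hw.2⟩
    rintro rfl
    simpa using hw.2
  have hGc : ContinuousOn (fun w => (G w).re) (closure W) := by
    intro w hw
    rcases eq_or_ne w 0 with rfl | hw0
    · have h0 : (G 0).re = 0 := by simp [hG]
      rw [ContinuousWithinAt, h0]
      have hlim : Tendsto (fun w : ℂ => 4 * L * w.im) (𝓝[closure W] 0) (𝓝 0) := by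
        have : ContinuousAt (fun w : ℂ => 4 * L * w.im) 0 := by fun_prop
        have := this.tendsto
        simp only [zero_im, mul_zero] at this
        exact this.mono_left nhdsWithin_le_nhds
      refine squeeze_zero_norm' ?_ hlim
      filter_upwards [self_mem_nhdsWithin] with y hy
      exact hGb y (hWcl y hy).1
    · have := hGd w (hlens w (hWcl w hw).1 hw0)
      exact (continuous_re.continuousAt.comp this.continuousAt).continuousWithinAt
  have hslit : ∀ w ∈ closure W, w ≠ 0 → w ∈ slitPlane := by
    intro w hw hw0
    right
    have : 0 < ‖w‖ ^ 2 := by positivity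
    have := (hWcl w hw).1
    intro h0
    rw [h0] at this
    linarith
  have hBc : ContinuousOn (fun w => (quadrantBarrier w).re) (closure W) := by
    intro w hw
    rcases eq_or_ne w 0 with rfl | hw0
    · have h1 : ContinuousAt (fun w : ℂ => w ^ (3 / 2 : ℂ)) 0 := by
        have h := continuousAt_cpow_const_of_re_pos (z := 0) (w := (3 / 2 : ℂ)) (Or.inl le_rfl)
          (by norm_num)
        exact h
      exact (continuous_re.continuousAt.comp
        (continuousAt_const.mul h1)).continuousWithinAt
    · have h1 : ContinuousAt (fun w : ℂ => w ^ (3 / 2 : ℂ)) w :=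
        continuousAt_id.cpow continuousAt_const (hslit w hw hw0)
      exact (continuous_re.continuousAt.comp
        (continuousAt_const.mul h1)).continuousWithinAt
  have hBd : DifferentiableOn ℂ (fun w => (A : ℂ) * quadrantBarrier w) W := by
    intro w hw
    have h1 : DifferentiableAt ℂ (fun w : ℂ => w ^ (3 / 2 : ℂ)) w :=
      differentiableAt_id.cpow (differentiableAt_const _)
        (hslit w (subset_closure hw) (hWne w hw).2.1)
    exact ((h1.const_mul _).const_mul _).differentiableWithinAt
  have hfr : ∀ w ∈ frontier W, |(G w).re| ≤ A * (quadrantBarrier w).re := by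
    intro w hw
    obtain ⟨h1, h2⟩ := hWcl w hw.1
    have him : 0 ≤ w.im := by
      have : 0 ≤ ‖w‖ ^ 2 := by positivity
      nlinarith
    have hlow := le_quadrantBarrier_re h2 him
    by_cases hre : w.re = 0
    · have h0 : (G w).re = 0 := by
        have : -conj w = w := by apply Complex.ext <;> simp [hre]
        simp [hG, this]
      rw [h0, abs_zero]
      exact mul_nonneg hA0.le (le_trans (by positivity) hlow)
    · have heq : ‖w‖ ^ 2 = 2 * r * w.im := by
        by_contra hne
        have : w ∈ W := ⟨(mem_ball_I_mul_iff hr).2 (lt_of_le_of_ne h1 hne),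
          lt_of_le_of_ne h2 (Ne.symm hre)⟩
        exact hw.2 (by rwa [hWo.interior_eq])
      have hs : √‖w‖ ^ 2 = ‖w‖ := Real.sq_sqrt (norm_nonneg _)
      have hs2 : √‖w‖ ≤ √(2 * r) := by
        apply Real.sqrt_le_sqrt
        have := im_le_norm w
        by_contra! hlt
        have hpos : 0 < ‖w‖ := by linarith
        nlinarith
      calc |(G w).re| ≤ 4 * L * w.im := hGb w h1
        _ = 2 * L / r * ‖w‖ ^ 2 := by rw [heq]; field_simp; ring
        _ = 2 * L / r * (√‖w‖ * √‖w‖ ^ 3) := by rw [← hs]; rw [hs]; rw [← hs]; ring_nf; simp [hs]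
        _ ≤ 2 * L / r * (√(2 * r) * √‖w‖ ^ 3) := by gcongr
        _ = A * (Real.cos (3 * Real.pi / 8) * √‖w‖ ^ 3) := by rw [hA]; field_simp
        _ ≤ _ := by gcongr
  have hWb : Bornology.IsBounded W := isBounded_ball.subset inter_subset_left
  have hWsub : W ⊆ ball (I * ρ) ρ := fun w hw => hlens w (hWne w hw).1 (hWne w hw).2.1
  have hGl : LocallyReOn (fun w => (G w).re) W := locallyReOn_re hWo (hGdiff.mono hWsub)
  have hBl : LocallyReOn (fun w => A * (quadrantBarrier w).re) W := by
    have := locallyReOn_re hWo hBd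
    simpa using this
  have hbW : ∀ w ∈ W, |(G w).re| ≤ A * √‖w‖ ^ 3 := by
    intro w hw
    have h1 := (hGl.sub hBl).le_of_frontier_le (m := 0) hWo hWb
      (hGc.sub (continuousOn_const.mul hBc))
      (fun z hz => by linarith [(abs_le.1 (hfr z hz)).2]) w hw
    have h2 := (hGl.neg.sub hBl).le_of_frontier_le (m := 0) hWo hWb
      (hGc.neg.sub (continuousOn_const.mul hBc))
      (fun z hz => by linarith [(abs_le.1 (hfr z hz)).1]) w hw
    have h3 := mul_le_mul_of_nonneg_left (quadrantBarrier_re_le w) hA0.le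
    rw [abs_le]; constructor <;> linarith
  have hball : ∀ w ∈ ball (I * d) (d / 2), |(G w).re| ≤ A * √(2 * d) ^ 3 := by
    intro w hw
    have hw1 : ‖w - I * d‖ < d / 2 := by simpa [dist_eq_norm] using hw
    have hw2 : ‖w‖ ≤ 2 * d := by
      have h := norm_add_le (w - I * d) (I * d)
      rw [sub_add_cancel] at h
      have : ‖I * (d : ℂ)‖ = d := by simp [abs_of_pos hd]
      linarith
    have hw3 : d / 2 < w.im := by
      have := (abs_im_le_norm (w - I * d)).trans_lt hw1
      simp at this
      linarith [(abs_lt.1 this).1]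
    have hw4 : ‖w‖ ^ 2 < 2 * r * w.im := by nlinarith [norm_nonneg w]
    have hs : √‖w‖ ≤ √(2 * d) := Real.sqrt_le_sqrt hw2
    refine le_trans ?_ (show A * √‖w‖ ^ 3 ≤ A * √(2 * d) ^ 3 by gcongr)
    rcases lt_trichotomy w.re 0 with hre | hre | hre
    · have hmem : -conj w ∈ W := by
        refine ⟨(mem_ball_I_mul_iff hr).2 (by simpa using hw4), ?_⟩
        simpa using hre
      have h1 := hbW _ hmem
      have h2 : (G (-conj w)).re = -(G w).re := by simp [hG]
      rw [h2, abs_neg, norm_neg, RCLike.norm_conj] at h1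
      exact h1
    · have h0 : (G w).re = 0 := by
        have : -conj w = w := by apply Complex.ext <;> simp [hre]
        simp [hG, this]
      rw [h0, abs_zero]; positivity
    · exact hbW w ⟨(mem_ball_I_mul_iff hr).2 hw4, hre⟩
  have hsub : ball (I * d) (d / 2) ⊆ ball (I * (ρ : ℂ)) ρ := by
    intro w hw
    have hw1 : ‖w - I * d‖ < d / 2 := by simpa [dist_eq_norm] using hw
    have hw2 : ‖w‖ ≤ 2 * d := by
      have h := norm_add_le (w - I * d) (I * d)
      rw [sub_add_cancel] at h
      have : ‖I * (d : ℂ)‖ = d := by simp [abs_of_pos hd]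
      linarith
    have hw3 : d / 2 < w.im := by
      have := (abs_im_le_norm (w - I * d)).trans_lt hw1
      simp at this
      linarith [(abs_lt.1 this).1]
    rw [mem_ball_I_mul_iff hρ]
    nlinarith [norm_nonneg w]
  have hfin := norm_deriv_le_of_abs_re_le (by positivity) (by positivity) (hGdiff.mono hsub) hball
  have hId : I * (d : ℂ) ∈ ball (I * (ρ : ℂ)) ρ := hsub (mem_ball_self (by positivity))
  have hId2 : -conj (I * (d : ℂ)) = I * d := by simp
  rw [(hGd _ hId).deriv, hId2, add_conj] at hfin
  have h2 : ‖((2 * (deriv F (I * d)).re : ℝ) : ℂ)‖ = 2 * |(deriv F (I * d)).re| := by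
    rw [norm_real, Real.norm_eq_abs, abs_mul, abs_two]
  push_cast at h2 hfin
  rw [h2] at hfin
  have hs : √(2 * d) ^ 2 = 2 * d := Real.sq_sqrt (by positivity)
  have h3 : 16 * (A * √(2 * d) ^ 3) / (d / 2) = 2 * (32 * A * √(2 * d)) := by
    rw [show √(2 * d) ^ 3 = √(2 * d) ^ 2 * √(2 * d) by ring, hs]
    field_simp; ring
  rw [h3] at hfin
  have h4 : 32 * A * √(2 * d) =
      64 * L * √(2 * r) / (r * Real.cos (3 * Real.pi / 8)) * √(2 * d) := by
    rw [hA]; ring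
  linarith

end

section

open InnerProductSpace Topology Filter

lemma _root_.IsPreconnected.subset_of_disjoint_frontier {X : Type*} [TopologicalSpace X]
    {s Ω : Set X} (hs : IsPreconnected s) (ho : IsOpen Ω) (hd : Disjoint s (frontier Ω))
    (hne : (s ∩ Ω).Nonempty) : s ⊆ Ω := by
  refine hs.subset_left_of_subset_union ho isClosed_closure.isOpen_compl
    (disjoint_compl_right.mono_left subset_closure) (fun x hx => ?_) hne
  by_contra h
  simp only [mem_union, mem_compl_iff, not_or, not_not] at h
  exact disjoint_left.1 hd hx ⟨h.2, by rw [ho.interior_eq]; exact h.1⟩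

/-- A harmonic function that is constant on the boundary near a point with tangent discs is
Lipschitz at that point. -/
lemma TangentBalls.abs_sub_le {Ω : Set ℂ} {ρ r B c : ℝ} {p T : ℂ} {ω : ℂ → ℝ} (ho : IsOpen Ω)
    (h : TangentBalls Ω ρ p T) (hr : 0 < r) (hrρ : 4 * r ≤ ρ) (hω : HarmonicOnNhd ω Ω)
    (hc : ContinuousOn ω (closure Ω)) (hfr : ∀ z ∈ frontier Ω ∩ closedBall p r, ω z = c)
    (hB0 : 0 ≤ B) (hB : ∀ z ∈ closure Ω ∩ closedBall p r, |ω z - c| ≤ B) :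
    ∀ z ∈ Ω ∩ ball p r, |ω z - c| ≤ 6 * B / r * ‖z - p‖ := by
  have hWo : IsOpen (Ω ∩ ball p r) := ho.inter isOpen_ball
  have hWb : Bornology.IsBounded (Ω ∩ ball p r) := isBounded_ball.subset inter_subset_right
  have hbar : Differentiable ℂ fun z => barrier r ((z - p) * conj T) := by
    unfold barrier; fun_prop
  have hωl := (hω.locallyReOn ho).mono (inter_subset_left (t := ball p r))
  have hωc : ContinuousOn ω (closure (Ω ∩ ball p r)) :=
    hc.mono fun z hz => (closure_inter_ball_subset hz).1
  have hl : ∀ s : ℝ, LocallyReOn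
      (fun z => s + 2 * B * (barrier r ((z - p) * conj T)).re) (Ω ∩ ball p r) := by
    intro s
    have := locallyReOn_re (F := fun z => (s : ℂ) + ((2 * B : ℝ) : ℂ) *
      barrier r ((z - p) * conj T)) hWo ((hbar.const_mul _).const_add _).differentiableOn
    simpa only [add_re, ofReal_re, re_ofReal_mul] using this
  have hbc : ∀ s : ℝ, ContinuousOn
      (fun z => s + 2 * B * (barrier r ((z - p) * conj T)).re) (closure (Ω ∩ ball p r)) := by
    intro s
    have := hbar.continuous
    fun_prop
  have hkey : ∀ z ∈ frontier (Ω ∩ ball p r),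
      |ω z - c| ≤ 2 * B * (barrier r ((z - p) * conj T)).re := by
    intro z hz
    obtain ⟨h1, h2, h3⟩ := frontier_inter_ball_subset ho hz
    have hn := norm_mul_conj_of_norm_eq_one h.norm_eq_one (z - p)
    have h4 := le_barrier_re hr hrρ (w := (z - p) * conj T) (by rwa [hn])
      (by rw [hn]; exact h.le_of_mem_closure z h1)
    rw [hn] at h4
    have hcb : z ∈ closedBall p r := by simpa [dist_eq_norm] using h2
    rcases h3 with h3 | h3
    · rw [hfr z ⟨h3, hcb⟩, sub_self, abs_zero]
      exact mul_nonneg (by positivity) (le_trans (by positivity) h4)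
    · refine (hB z ⟨h1, hcb⟩).trans ?_
      rw [h3] at h4
      have : r ^ 2 / (2 * r ^ 2) = 1 / 2 := by field_simp
      rw [this] at h4
      nlinarith
  intro z hz
  have h1 := (hωl.sub (hl c)).le_of_frontier_le (m := 0) hWo hWb (hωc.sub (hbc c))
    (fun y hy => by linarith [(abs_le.1 (hkey y hy)).2]) z hz
  have h2 := (hωl.neg.sub (hl (-c))).le_of_frontier_le (m := 0) hWo hWb (hωc.neg.sub (hbc (-c)))
    (fun y hy => by linarith [(abs_le.1 (hkey y hy)).1]) z hz
  have hn := norm_mul_conj_of_norm_eq_one h.norm_eq_one (z - p)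
  have hzr : ‖z - p‖ < r := by simpa [dist_eq_norm] using hz.2
  have h3 := barrier_re_le hr (w := (z - p) * conj T) (by rw [hn]; exact hzr.le)
  rw [hn] at h3
  have h4 : 2 * B * (barrier r ((z - p) * conj T)).re ≤ 6 * B / r * ‖z - p‖ := by
    calc _ ≤ 2 * B * (3 * ‖z - p‖ / r) := by gcongr
      _ = _ := by ring
  rw [abs_le]
  constructor <;> linarith

/-- An interior point whose nearest boundary point is `p` lies on the inner normal at `p`. -/
lemma TangentBalls.eq_add_of_ball_subset {Ω : Set ℂ} {ρ d : ℝ} {p T z : ℂ} (hρ : 0 < ρ)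
    (h : TangentBalls Ω ρ p T) (hd : 0 < d) (hzd : ‖z - p‖ = d) (hball : ball z d ⊆ Ω) :
    z = p + T * (I * d) := by
  have hn := norm_mul_conj_of_norm_eq_one h.norm_eq_one
  have hout : Disjoint (ball z d) (ball (p - T * (I * ρ)) ρ) := by
    rw [disjoint_left]
    intro y hy hy2
    have h1 := h.le y (hball hy)
    have h2 : (y - p) * conj T + I * ρ = (y - (p - T * (I * ρ))) * conj T := by
      linear_combination (-I * ρ) * conj_mul_self_of_norm_eq_one h.norm_eq_one
    rw [mem_ball, dist_eq_norm, ← hn, ← h2] at hy2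
    rw [← hn] at h1
    have h3 : ‖(y - p) * conj T + I * ρ‖ ^ 2 < ρ ^ 2 := by gcongr
    generalize (y - p) * conj T = w at h1 h3
    rw [Complex.sq_norm, normSq_apply] at h1 h3
    simp at h3
    nlinarith
  rw [disjoint_ball_ball_iff hd hρ, dist_eq_norm, ← hn] at hout
  have h2 : (z - (p - T * (I * ρ))) * conj T = (z - p) * conj T + I * ρ := by
    linear_combination (I * ρ) * conj_mul_self_of_norm_eq_one h.norm_eq_one
  rw [h2] at hout
  have hw : (z - p) * conj T = I * d := by
    rw [← hn] at hzd
    generalize (z - p) * conj T = w at hout hzd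
    have h3 : (d + ρ) ^ 2 ≤ ‖w + I * ρ‖ ^ 2 := by gcongr
    have h4 : ‖w‖ ^ 2 = d ^ 2 := by rw [hzd]
    rw [Complex.sq_norm, normSq_apply] at h3 h4
    simp at h3
    have h5 : d ≤ w.im := by nlinarith
    have h6 : w.re = 0 := by nlinarith
    have h7 : w.im = d := by
      rw [h6] at h4; nlinarith
    apply Complex.ext <;> simp [h6, h7]
  linear_combination T * hw - (z - p) * conj_mul_self_of_norm_eq_one h.norm_eq_one

/-- The inner tangent disc is contained in the domain. -/
lemma TangentBalls.mem_of_norm_sq_lt {Ω : Set ℂ} {ρ d : ℝ} {p T z : ℂ} (ho : IsOpen Ω)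
    (h : TangentBalls Ω ρ p T) (hd : 0 < d) (hdρ : d < 2 * ρ) (hz : z = p + T * (I * d))
    (hzΩ : z ∈ Ω) {w : ℂ} (hw : ‖w‖ ^ 2 < 2 * ρ * w.im) : p + T * w ∈ Ω := by
  have hρ : 0 < ρ := by linarith
  have hmul : ∀ w : ℂ, (p + T * w - p) * conj T = w := by
    intro w
    linear_combination w * conj_mul_self_of_norm_eq_one h.norm_eq_one
  have hpre : IsPreconnected ((fun w => p + T * w) '' ball (I * (ρ : ℂ)) ρ) :=
    (convex_ball _ _).isPreconnected.image _ (by fun_prop)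
  refine hpre.subset_of_disjoint_frontier ho ?_ ⟨z, ⟨I * d, ?_, hz.symm⟩, hzΩ⟩
    ⟨w, (mem_ball_I_mul_iff hρ).2 hw, rfl⟩
  · rw [disjoint_left]
    rintro _ ⟨y, hy, rfl⟩ hf
    have h1 := h.frontier_le _ hf
    rw [← norm_mul_conj_of_norm_eq_one h.norm_eq_one (p + T * y - p), hmul] at h1
    rw [mem_ball_I_mul_iff hρ] at hy
    have := le_abs_self y.im
    nlinarith
  · rw [mem_ball_I_mul_iff hρ]
    simp [abs_of_pos hd]
    nlinarith

/-- Boundary behaviour of the complex gradient of a harmonic function that is locally constant on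
the boundary of a domain with tangent discs. -/
lemma exists_gradient_bounds {Ω : Set ℂ} {ρ : ℝ} {ω : ℂ → ℝ} (ho : IsOpen Ω)
    (hb : Bornology.IsBounded Ω) (hρ : 0 < ρ)
    (hT : ∀ p ∈ frontier Ω, ∃ T, TangentBalls Ω ρ p T)
    (hω : HarmonicOnNhd ω Ω) (hc : ContinuousOn ω (closure Ω))
    (hfr : ∀ z ∈ frontier Ω, ω z = 0 ∨ ω z = 1) :
    ∃ C δ : ℝ, 0 < δ ∧ ∀ p ∈ frontier Ω, ∀ T, TangentBalls Ω ρ p T → ∀ z ∈ Ω,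
      ‖z - p‖ < δ → ball z ‖z - p‖ ⊆ Ω →
      ‖(pdx ω z : ℂ) - I * (pdy ω z : ℂ)‖ ≤ C ∧
      |(((pdx ω z : ℂ) - I * (pdy ω z : ℂ)) * T).re| ≤ C * √‖z - p‖ := by
  have huc := hb.isCompact_closure.uniformContinuousOn_of_continuous hc
  rw [Metric.uniformContinuousOn_iff] at huc
  obtain ⟨η, hη, huc⟩ := huc (1 / 2) (by norm_num)
  obtain ⟨r, hr, hrη, hrρ⟩ : ∃ r : ℝ, 0 < r ∧ r < η ∧ 4 * r ≤ ρ :=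
    ⟨min (η / 2) (ρ / 4), by positivity, by linarith [min_le_left (η / 2) (ρ / 4)],
      by linarith [min_le_right (η / 2) (ρ / 4)]⟩
  have hconst : ∀ p ∈ frontier Ω, ∀ q ∈ frontier Ω, dist q p ≤ r → ω q = ω p := by
    intro p hp q hq hpq
    have := huc q hq.1 p hp.1 (by linarith)
    rw [Real.dist_eq, abs_lt] at this
    rcases hfr p hp with h1 | h1 <;> rcases hfr q hq with h2 | h2 <;>
      rw [h1, h2] at this ⊢ <;> norm_num at this
  have hlip : ∀ p ∈ frontier Ω, ∀ z ∈ Ω, ‖z - p‖ < r → |ω z - ω p| ≤ 3 / r * ‖z - p‖ := by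
    intro p hp z hz hzp
    obtain ⟨T, h⟩ := hT p hp
    have := h.abs_sub_le ho hr hrρ hω hc (c := ω p) (B := 1 / 2)
      (fun q hq => hconst p hp q hq.1 hq.2) (by norm_num)
      (fun q hq => by
        have := huc q hq.1 p hp.1 (lt_of_le_of_lt hq.2 hrη)
        rw [Real.dist_eq] at this
        exact this.le) z ⟨hz, by simpa [dist_eq_norm] using hzp⟩
    calc _ ≤ _ := this
      _ = _ := by ring
  have hne : Ω ≠ univ := by
    rintro rfl
    exact NormedSpace.unbounded_univ ℝ ℂ hb
  have hlip2 : ∀ p ∈ frontier Ω, ∀ z ∈ Ω, ‖z - p‖ ≤ r / 2 → ∀ x ∉ Ω,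
      |ω z - ω p| ≤ 3 / r * ‖z - x‖ := by
    intro p hp z hz hzp x hx
    obtain ⟨q, hq, hqd⟩ := exists_mem_frontier_infDist_compl_eq_dist hz hne
    have hpΩ : p ∈ Ωᶜ := fun h => hp.2 (by rwa [ho.interior_eq])
    have h1 := infDist_le_dist_of_mem (x := z) hpΩ
    have h2 := infDist_le_dist_of_mem (x := z) (s := Ωᶜ) hx
    rw [hqd] at h1 h2
    rw [dist_eq_norm] at h1 h2
    have h3 : dist q p ≤ r := by
      have := dist_triangle_left q p z
      rw [dist_eq_norm z q, dist_eq_norm z p] at this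
      rw [dist_eq_norm z p] at h1
      linarith
    rw [dist_eq_norm z p] at h1
    rw [← hconst p hp q hq h3]
    calc _ ≤ 3 / r * ‖z - q‖ := hlip q hq z hz (by linarith)
      _ ≤ _ := by rw [dist_eq_norm] at h2; gcongr
  set K : ℝ := 64 * (3 / r) * √(2 * (r / 16)) / (r / 16 * Real.cos (3 * Real.pi / 8)) * √2 with hK
  have hcos : 0 < Real.cos (3 * Real.pi / 8) := Real.cos_pos_of_mem_Ioo
    ⟨by linarith [Real.pi_pos], by linarith [Real.pi_pos]⟩
  have hK0 : 0 ≤ K := by positivity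
  refine ⟨max (96 / r) K, r / 64, by positivity, fun p hp T h z hz hzp hball => ?_⟩
  set d : ℝ := ‖z - p‖ with hd
  have hpΩ : p ∉ Ω := fun h => hp.2 (by rwa [ho.interior_eq])
  have hd0 : 0 < d := by
    rw [hd, norm_pos_iff, sub_ne_zero]
    rintro rfl
    exact hpΩ hz
  constructor
  · refine le_trans ?_ (le_max_left _ _)
    obtain ⟨F, hF, hE⟩ := HarmonicOnNhd.exists_analyticOnNhd_ball_re_eq
      (f := ω) (z := z) (R := d) fun y hy => hω y (hball hy)
    have hF' : DifferentiableOn ℂ F (ball z d) := hF.differentiableOn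
    rw [pdx_sub_pdy_eq_deriv (hF z (mem_ball_self hd0)).differentiableAt
      (hE.eventuallyEq_of_mem (ball_mem_nhds z hd0)).symm]
    have := norm_deriv_le_of_abs_re_le (F := fun y => F y - ω p) (z := z) (r := d)
      (m := 6 * d / r) hd0 (by positivity) (hF'.sub_const _) (fun y hy => by
        have hyz : ‖y - z‖ < d := by simpa [dist_eq_norm] using hy
        have h1 : ‖y - p‖ ≤ 2 * d := by
          have := norm_add_le (y - z) (z - p)
          rw [sub_add_sub_cancel] at this
          linarith
        have h2 := hlip p hp y (hball hy) (by linarith)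
        have h3 : (F y).re = ω y := hE hy
        rw [sub_re, ofReal_re, h3]
        calc _ ≤ _ := h2
          _ ≤ 3 / r * (2 * d) := by gcongr
          _ = _ := by ring)
    rw [deriv_sub_const] at this
    calc _ ≤ _ := this
      _ = _ := by field_simp; norm_num
  · have hzeq := h.eq_add_of_ball_subset hρ hd0 rfl hball
    have hin : ∀ w : ℂ, ‖w‖ ^ 2 < 2 * ρ * w.im → p + T * w ∈ Ω := fun w hw =>
      h.mem_of_norm_sq_lt ho hd0 (by linarith) hzeq hz hw
    have hTn : ∀ w, ‖T * w‖ = ‖w‖ := fun w => by rw [norm_mul, h.norm_eq_one, one_mul]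
    have hmul : ∀ w : ℂ, (w - p) * conj T * T = w - p := by
      intro w
      linear_combination (w - p) * conj_mul_self_of_norm_eq_one h.norm_eq_one
    have hsub : ball (p + T * (I * ρ)) ρ ⊆ Ω := by
      intro y hy
      have : y = p + T * ((y - p) * conj T) := by linear_combination -hmul y
      rw [this]
      refine hin _ ((mem_ball_I_mul_iff hρ).1 ?_)
      rw [mem_ball, dist_eq_norm] at hy ⊢
      rw [← hTn]
      have h2 : T * ((y - p) * conj T - I * ρ) = y - (p + T * (I * ρ)) := by
        linear_combination hmul y
      rwa [h2]
    obtain ⟨F, hF, hE⟩ := HarmonicOnNhd.exists_analyticOnNhd_ball_re_eq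
      (f := ω) fun y hy => hω y (hsub hy)
    have hmaps : ∀ w ∈ ball (I * (ρ : ℂ)) ρ, p + T * w ∈ ball (p + T * (I * ρ)) ρ := by
      intro w hw
      rw [mem_ball, dist_eq_norm] at hw ⊢
      have h2 : p + T * w - (p + T * (I * ρ)) = T * (w - I * ρ) := by ring
      rwa [h2, hTn]
    have hdw : I * (d : ℂ) ∈ ball (I * (ρ : ℂ)) ρ := by
      rw [mem_ball_I_mul_iff hρ]
      simp [abs_of_pos hd0]
      nlinarith
    have hzb : z ∈ ball (p + T * (I * ρ)) ρ := by
      rw [hzeq]; exact hmaps _ hdw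
    have hder : ∀ w ∈ ball (I * (ρ : ℂ)) ρ,
        HasDerivAt (fun w => F (p + T * w)) (deriv F (p + T * w) * T) w := by
      intro w hw
      have h1 : HasDerivAt (fun w => p + T * w) T w := by
        simpa using ((hasDerivAt_id w).const_mul T).const_add p
      exact (hF _ (hmaps w hw)).differentiableAt.hasDerivAt.comp w h1
    have hmain := abs_re_deriv_le_sqrt (F := fun w => F (p + T * w)) (ρ := ρ) (r := r / 16)
      (L := 3 / r) (c := ω p) (d := d) (by positivity) (by linarith) (by positivity)
      (fun w hw => (hder w hw).differentiableAt.differentiableWithinAt)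
      (fun w hw hw0 => by
        have hw1 : 0 < ‖w‖ ^ 2 := by positivity
        have hw2 : 0 < w.im := by nlinarith
        have hw3 : ‖w‖ ^ 2 < 2 * ρ * w.im := by nlinarith
        have hw4 : ‖w‖ ≤ r / 2 := by
          have := im_le_norm w
          have : 0 < ‖w‖ := by positivity
          nlinarith
        have h3 : (F (p + T * w)).re = ω (p + T * w) :=
          hE (hmaps w ((mem_ball_I_mul_iff hρ).2 hw3))
        have hx : p + T * conj w ∉ Ω := by
          intro hx
          have h4 := h.le _ hx
          rw [← norm_mul_conj_of_norm_eq_one h.norm_eq_one] at h4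
          have h5 : (p + T * conj w - p) * conj T = conj w := by
            linear_combination conj w * conj_mul_self_of_norm_eq_one h.norm_eq_one
          rw [h5, RCLike.norm_conj, conj_im] at h4
          linarith
        have h6 := hlip2 p hp _ (hin w hw3) (by rw [add_sub_cancel_left, hTn]; exact hw4) _ hx
        have h7 : p + T * w - (p + T * conj w) = T * (w - conj w) := by ring
        rw [h7, hTn, sub_conj] at h6
        rw [h3]
        calc _ ≤ _ := h6
          _ = _ := by simp [abs_of_pos hw2]; ring)
      hd0 (by linarith)
    rw [(hder _ hdw).deriv, ← hzeq] at hmain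
    rw [pdx_sub_pdy_eq_deriv (hF z hzb).differentiableAt
      (hE.eventuallyEq_of_mem (isOpen_ball.mem_nhds hzb)).symm]
    refine (hmain.trans (le_of_eq ?_)).trans
      (mul_le_mul_of_nonneg_right (le_max_right _ _) (Real.sqrt_nonneg d))
    rw [hK, Real.sqrt_mul (by norm_num) d]
    ring

end

section

open InnerProductSpace Topology Filter

section PeriodicCurve

variable {γ : ℝ → ℂ}

/-- A function with period `2 * π` that is injective on a fundamental interval is injective up to
periods. -/
lemma eq_of_periodic_of_injOn (hp : Function.Periodic γ (2 * Real.pi))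
    (hi : InjOn γ (Ico 0 (2 * Real.pi))) {s t : ℝ} (h : γ s = γ t) (hst : |s - t| ≤ Real.pi) :
    s = t := by
  have hpi := Real.two_pi_pos
  have key : ∀ x, γ (toIcoMod hpi 0 x) = γ x := by
    intro x
    have h1 := self_sub_toIcoDiv_zsmul hpi 0 x
    rw [← h1, hp.sub_zsmul_eq]
  have hm : ∀ x, toIcoMod hpi 0 x ∈ Ico 0 (2 * Real.pi) := by
    intro x
    simpa using toIcoMod_mem_Ico hpi 0 x
  have h1 := hi (hm s) (hm t) (by rw [key, key, h])
  obtain ⟨n, hn⟩ := (toIcoMod_eq_toIcoMod hpi).1 h1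
  rw [zsmul_eq_mul] at hn
  have hn0 : n = 0 := by
    by_contra h0
    have h2 : (1 : ℝ) ≤ |(n : ℝ)| := by exact_mod_cast Int.one_le_abs h0
    have h3 : |t - s| = |(n : ℝ)| * (2 * Real.pi) := by rw [hn, abs_mul, abs_of_pos hpi]
    rw [abs_sub_comm] at h3
    nlinarith
  rw [hn0, Int.cast_zero, zero_mul] at hn
  linarith

lemma deriv_periodic (hp : Function.Periodic γ (2 * Real.pi)) :
    Function.Periodic (deriv γ) (2 * Real.pi) := by
  intro x
  rw [← deriv_comp_add_const, funext hp]

lemma exists_mul_abs_le_norm_sub (hs : ContDiff ℝ 1 γ)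
    (hp : Function.Periodic γ (2 * Real.pi))
    (hi : InjOn γ (Ico 0 (2 * Real.pi))) (hd : ∀ t, deriv γ t ≠ 0) :
    ∃ c : ℝ, 0 < c ∧ ∀ t h, |h| ≤ Real.pi → c * |h| ≤ ‖γ (t + h) - γ t‖ := by
  have hdc : Continuous (deriv γ) := hs.continuous_deriv le_rfl
  set g : ℝ × ℝ → ℂ := fun x => ∫ θ in (0:ℝ)..1, deriv γ (x.1 + θ * x.2) with hg
  have hgc : Continuous g := by
    apply intervalIntegral.continuous_parametric_intervalIntegral_of_continuous'
    fun_prop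
  have hgm : ∀ t h : ℝ, h * g (t, h) = γ (t + h) - γ t := by
    intro t h
    have h1 : ∀ θ ∈ uIcc (0:ℝ) 1, HasDerivAt (fun θ : ℝ => γ (t + θ * h))
        ((h : ℂ) * deriv γ (t + θ * h)) θ := by
      intro θ _
      have h2 : HasDerivAt (fun θ : ℝ => t + θ * h) h θ := by
        simpa using ((hasDerivAt_id θ).mul_const h).const_add t
      have := (hs.differentiable one_ne_zero (t + θ * h)).hasDerivAt.scomp θ h2
      simpa [Function.comp_def] using this
    have := intervalIntegral.integral_eq_sub_of_hasDerivAt h1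
      (Continuous.intervalIntegrable (by fun_prop) _ _)
    rw [intervalIntegral.integral_const_mul] at this
    simpa [hg] using this
  have hK : IsCompact (Icc 0 (2 * Real.pi) ×ˢ Icc (-Real.pi) Real.pi) :=
    isCompact_Icc.prod isCompact_Icc
  have hpi := Real.pi_pos
  obtain ⟨x, hx, hmin⟩ := hK.exists_isMinOn ⟨(0, 0), by constructor <;> constructor <;> simp [hpi.le]⟩
    (hgc.norm.continuousOn)
  have hpos : 0 < ‖g x‖ := by
    rw [norm_pos_iff]
    intro h0
    have h1 := hgm x.1 x.2
    rw [h0, mul_zero] at h1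
    have h2 := eq_of_periodic_of_injOn hp hi (sub_eq_zero.1 h1.symm)
      (by rw [add_sub_cancel_left, abs_le]; exact hx.2)
    have h3 : x.2 = 0 := by linarith
    have h4 : g x = deriv γ x.1 := by simp [hg, h3]
    exact hd x.1 (h4 ▸ h0)
  refine ⟨‖g x‖, hpos, fun t h hh => ?_⟩
  have h1 : γ (t + h) - γ t = γ (toIcoMod Real.two_pi_pos 0 t + h) - γ (toIcoMod Real.two_pi_pos 0 t) := by
    have h2 := self_sub_toIcoDiv_zsmul Real.two_pi_pos 0 t
    rw [← h2, hp.sub_zsmul_eq, sub_add_eq_add_sub, hp.sub_zsmul_eq]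
  have h2 : ‖g x‖ ≤ ‖g (toIcoMod Real.two_pi_pos 0 t, h)‖ := hmin
    ⟨by have := toIcoMod_mem_Ico Real.two_pi_pos 0 t; rw [zero_add] at this; exact ⟨this.1, this.2.le⟩,
      abs_le.1 hh⟩
  rw [h1, ← hgm, norm_mul, norm_real, Real.norm_eq_abs, mul_comm]
  gcongr

lemma exists_norm_sub_sub_le (hs : ContDiff ℝ 2 γ) (hp : Function.Periodic γ (2 * Real.pi)) :
    ∃ M : ℝ, 0 < M ∧ ∀ t h, ‖γ (t + h) - γ t - h * deriv γ t‖ ≤ M * h ^ 2 := by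
  have hs1 : ContDiff ℝ 1 (deriv γ) := by
    have : ContDiff ℝ (1 + 1) γ := by simpa [one_add_one_eq_two] using hs
    exact (contDiff_succ_iff_deriv.1 this).2.2
  have hdc : Continuous (deriv (deriv γ)) := hs1.continuous_deriv le_rfl
  obtain ⟨M, hM⟩ := (deriv_periodic (deriv_periodic hp)).isBounded_of_continuous
    Real.two_pi_pos.ne' hdc |>.exists_norm_le
  have hM' : ∀ t, ‖deriv (deriv γ) t‖ ≤ |M| + 1 := fun t =>
    (hM _ ⟨t, rfl⟩).trans (by linarith [le_abs_self M])
  refine ⟨|M| + 1, by positivity, fun t h => ?_⟩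
  have h1 : ∀ s, ‖deriv γ s - deriv γ t‖ ≤ (|M| + 1) * |s - t| := fun s => by
    have := convex_univ.norm_image_sub_le_of_norm_deriv_le (f := deriv γ) (x := t) (y := s)
      (fun x _ => hs1.differentiable one_ne_zero x) (fun x _ => hM' x) trivial trivial
    simpa using this
  have h2 : ∀ s ∈ closedBall t |h|, HasDerivWithinAt (fun s : ℝ => γ s - (s - t : ℝ) * deriv γ t)
      (deriv γ s - deriv γ t) (closedBall t |h|) s := by
    intro s _
    have h3 : HasDerivAt (fun s : ℝ => ((s - t : ℝ) : ℂ)) 1 s := by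
      simpa using ((hasDerivAt_id s).sub_const t).ofReal_comp
    have := ((hs.differentiable two_ne_zero s).hasDerivAt.sub (h3.mul_const (deriv γ t)))
    rw [one_mul] at this
    exact this.hasDerivWithinAt
  have := (convex_closedBall t |h|).norm_image_sub_le_of_norm_hasDerivWithin_le
    (C := (|M| + 1) * |h|) h2 (fun s hs => (h1 s).trans (by
      have : |s - t| ≤ |h| := by simpa [Real.dist_eq] using hs
      gcongr)) (mem_closedBall_self (abs_nonneg h)) (y := t + h) (by simp)
  simp only [sub_self, ofReal_zero, zero_mul, sub_zero, add_sub_cancel_left, Real.norm_eq_abs] at this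
  rw [mul_assoc, abs_mul_abs_self, ← pow_two] at this
  rwa [sub_right_comm] at this

end PeriodicCurve

end

section

open InnerProductSpace Topology Filter

section PeriodicCurve

variable {γ : ℝ → ℂ}

/-- The winding integral of a closed curve is constant on connected sets avoiding the curve. -/
lemma integral_deriv_div_sub_eq (hs : ContDiff ℝ 1 γ) (hp : Function.Periodic γ (2 * Real.pi))
    {Ω : Set ℂ} (ho : IsOpen Ω) (hc : IsPreconnected Ω) (hd : ∀ t, γ t ∉ Ω) {a b : ℂ}
    (ha : a ∈ Ω) (hb : b ∈ Ω) :
    ∫ t in (0 : ℝ)..2 * Real.pi, deriv γ t / (γ t - a) =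
      ∫ t in (0 : ℝ)..2 * Real.pi, deriv γ t / (γ t - b) := by
  have hdc : Continuous (deriv γ) := hs.continuous_deriv le_rfl
  have hne : ∀ x ∈ Ω, ∀ t, γ t - x ≠ 0 := by
    intro x hx t h
    exact hd t (by rwa [sub_eq_zero.1 h])
  have hder : ∀ x ∈ Ω, HasDerivAt (fun x => ∫ t in (0 : ℝ)..2 * Real.pi, deriv γ t / (γ t - x))
      0 x := by
    intro x hx
    obtain ⟨r, hr, hsub⟩ := Metric.isOpen_iff.1 ho x hx
    obtain ⟨K, hK⟩ := (deriv_periodic hp).isBounded_of_continuous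
      Real.two_pi_pos.ne' hdc |>.exists_norm_le
    have hcont : ∀ y ∈ Ω, Continuous fun t => deriv γ t / (γ t - y) := fun y hy =>
      hdc.div (hs.continuous.sub continuous_const) (hne y hy)
    have hcont2 : Continuous fun t => deriv γ t / (γ t - x) ^ 2 :=
      hdc.div ((hs.continuous.sub continuous_const).pow 2) fun t => pow_ne_zero 2 (hne x hx t)
    have h0 : ∫ t in (0 : ℝ)..2 * Real.pi, deriv γ t / (γ t - x) ^ 2 = 0 := by
      have h1 : ∀ t ∈ uIcc (0 : ℝ) (2 * Real.pi),
          HasDerivAt (fun t => -(γ t - x)⁻¹) (deriv γ t / (γ t - x) ^ 2) t := by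
        intro t _
        exact (((hs.differentiable one_ne_zero t).hasDerivAt.sub_const x).inv
          (hne x hx t)).neg.congr_deriv (by ring)
      rw [intervalIntegral.integral_eq_sub_of_hasDerivAt h1 (hcont2.intervalIntegrable _ _)]
      have := hp 0
      rw [zero_add] at this
      rw [this, sub_self]
    have := (intervalIntegral.hasDerivAt_integral_of_dominated_loc_of_deriv_le
      (F := fun x t => deriv γ t / (γ t - x)) (F' := fun x t => deriv γ t / (γ t - x) ^ 2)
      (x₀ := x) (a := 0) (b := 2 * Real.pi) (μ := volume) (bound := fun _ => K / (r / 2) ^ 2)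
      (s := ball x (r / 2)) (ball_mem_nhds x (by positivity)) ?_
      ((hcont x hx).intervalIntegrable _ _) hcont2.aestronglyMeasurable ?_
      intervalIntegrable_const ?_).2
    · rwa [h0] at this
    · filter_upwards [ball_mem_nhds x hr] with y hy
      exact (hcont y (hsub hy)).aestronglyMeasurable
    · refine Eventually.of_forall fun t _ y hy => ?_
      have h1 : r / 2 ≤ ‖γ t - y‖ := by
        have h2 : r ≤ ‖γ t - x‖ := by
          by_contra! hlt
          exact hd t (hsub (by simpa [dist_eq_norm] using hlt))
        have h3 : ‖y - x‖ < r / 2 := by simpa [dist_eq_norm] using hy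
        have := norm_add_le (γ t - y) (y - x)
        rw [sub_add_sub_cancel] at this
        linarith
      rw [norm_div, norm_pow]
      have := hK _ ⟨t, rfl⟩
      have := (norm_nonneg _).trans this
      gcongr
    · refine Eventually.of_forall fun t _ y hy => ?_
      have hyΩ : y ∈ Ω := hsub (ball_subset_ball (by linarith) hy)
      exact (((hasDerivAt_id y).const_sub (γ t)).inv (hne y hyΩ t)).const_mul (deriv γ t)
        |>.congr_deriv (by simp [div_eq_mul_inv])
  exact ho.is_const_of_deriv_eq_zero hc
    (fun x hx => (hder x hx).differentiableAt.differentiableWithinAt)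
    (fun x hx => (hder x hx).deriv) ha hb

lemma norm_sq_add_sq_le_of_abs_im_le {ρ ε : ℝ} {T x : ℂ} (hε : 0 < ε) (hερ : 2 * ε ≤ ρ)
    (hT : ‖T‖ = 1) (h : 2 * ρ * |(x * conj T).im| ≤ ‖x‖ ^ 2) :
    (‖x‖ ^ 2 + ε ^ 2) / 2 ≤ ‖x - I * ε * T‖ ^ 2 ∧ (‖x‖ ^ 2 + ε ^ 2) / 2 ≤ ‖x + I * ε * T‖ ^ 2 := by
  have h1 : ‖x - I * ε * T‖ = ‖x * conj T - I * ε‖ := by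
    rw [← norm_mul_conj_of_norm_eq_one hT]
    congr 1
    linear_combination (-I * ε) * conj_mul_self_of_norm_eq_one hT
  have h2 : ‖x + I * ε * T‖ = ‖x * conj T + I * ε‖ := by
    rw [← norm_mul_conj_of_norm_eq_one hT]
    congr 1
    linear_combination (I * ε) * conj_mul_self_of_norm_eq_one hT
  rw [h1, h2, ← norm_mul_conj_of_norm_eq_one hT x]
  rw [← norm_mul_conj_of_norm_eq_one hT x] at h
  generalize x * conj T = w at h
  have h3 := le_abs_self w.im
  have h4 := neg_abs_le w.im
  have h5 : 4 * ε * |w.im| ≤ 2 * ρ * |w.im| := by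
    have := abs_nonneg w.im
    nlinarith
  have hε' : 4 * ε * w.im ≤ 4 * ε * |w.im| := by gcongr
  have hε'' : 4 * ε * (-|w.im|) ≤ 4 * ε * w.im := by gcongr
  rw [Complex.sq_norm, normSq_apply] at h
  rw [Complex.sq_norm, Complex.sq_norm, Complex.sq_norm, normSq_apply, normSq_apply, normSq_apply]
  simp
  constructor <;> nlinarith

/-- The jump of the winding integral across the curve. -/
lemma tendsto_integral_deriv_div_sub_sub (hs : ContDiff ℝ 1 γ)
    (hp : Function.Periodic γ (2 * Real.pi)) {t₀ c ρ k : ℝ} {T : ℂ} (hc : 0 < c) (hρ : 0 < ρ)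
    (hk : 0 < k) (hT : ‖T‖ = 1) (hkT : deriv γ t₀ = k * T)
    (hlow : ∀ h, |h| ≤ Real.pi → c * |h| ≤ ‖γ (t₀ + h) - γ t₀‖)
    (him : ∀ t, 2 * ρ * |((γ t - γ t₀) * conj T).im| ≤ ‖γ t - γ t₀‖ ^ 2) :
    Tendsto (fun ε : ℝ => (∫ t in (0 : ℝ)..2 * Real.pi, deriv γ t / (γ t - (γ t₀ + I * ε * T))) -
      ∫ t in (0 : ℝ)..2 * Real.pi, deriv γ t / (γ t - (γ t₀ - I * ε * T))) (𝓝[>] 0)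
      (𝓝 (2 * Real.pi * I)) := by
  have hdc : Continuous (deriv γ) := hs.continuous_deriv le_rfl
  have hT0 : T ≠ 0 := by rw [← norm_pos_iff, hT]; exact one_pos
  obtain ⟨K, hK⟩ := (deriv_periodic hp).isBounded_of_continuous
    Real.two_pi_pos.ne' hdc |>.exists_norm_le
  have hK0 : 0 ≤ K := (norm_nonneg _).trans (hK _ ⟨0, rfl⟩)
  set f : ℝ → ℝ → ℂ := fun ε t =>
    deriv γ t * (2 * I * ε * T) / ((γ t - γ t₀) ^ 2 + (ε * T) ^ 2) with hf
  set g : ℝ → ℝ → ℂ := fun ε =>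
    (Ioc (-(Real.pi / ε)) (Real.pi / ε)).indicator fun s => ε * f ε (t₀ + ε * s) with hg
  have hne : ∀ ε : ℝ, 0 < ε → 2 * ε ≤ ρ → ∀ t, γ t - γ t₀ - I * ε * T ≠ 0 ∧
      γ t - γ t₀ + I * ε * T ≠ 0 := by
    intro ε hε hερ t
    have := norm_sq_add_sq_le_of_abs_im_le hε hερ hT (him t)
    constructor
    · intro h
      have h1 := this.1
      rw [h, norm_zero] at h1
      have := sq_nonneg ‖γ t - γ t₀‖
      nlinarith
    · intro h
      have h1 := this.2
      rw [h, norm_zero] at h1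
      have := sq_nonneg ‖γ t - γ t₀‖
      nlinarith
  have hfac : ∀ (ε : ℝ) t, (γ t - γ t₀) ^ 2 + (ε * T) ^ 2 =
      (γ t - γ t₀ - I * ε * T) * (γ t - γ t₀ + I * ε * T) := by
    intro ε t
    linear_combination ((ε * T) ^ 2) * I_sq
  have hfc : ∀ ε : ℝ, 0 < ε → 2 * ε ≤ ρ → Continuous (f ε) := by
    intro ε hε hερ
    refine (hdc.mul continuous_const).div (by have := hs.continuous; fun_prop) fun t => ?_
    rw [hfac]
    exact mul_ne_zero (hne ε hε hερ t).1 (hne ε hε hερ t).2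
  have hρev : ∀ᶠ ε : ℝ in 𝓝[>] 0, 0 < ε ∧ 2 * ε ≤ ρ := by
    filter_upwards [Ioo_mem_nhdsGT (show (0 : ℝ) < ρ / 2 by positivity)] with ε hε
    exact ⟨hε.1, by linarith [hε.2]⟩
  have heq : ∀ᶠ ε : ℝ in 𝓝[>] 0,
      (∫ t in (0 : ℝ)..2 * Real.pi, deriv γ t / (γ t - (γ t₀ + I * ε * T))) -
      (∫ t in (0 : ℝ)..2 * Real.pi, deriv γ t / (γ t - (γ t₀ - I * ε * T))) = ∫ s, g ε s := by
    filter_upwards [hρev] with ε hε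
    have hn := hne ε hε.1 hε.2
    have e1 : ∀ t, γ t - (γ t₀ + I * ε * T) = γ t - γ t₀ - I * ε * T := fun t => by ring
    have e2 : ∀ t, γ t - (γ t₀ - I * ε * T) = γ t - γ t₀ + I * ε * T := fun t => by ring
    simp only [e1, e2]
    have i1 : Continuous fun t => deriv γ t / (γ t - γ t₀ - I * ε * T) :=
      hdc.div (by have := hs.continuous; fun_prop) fun t => (hn t).1
    have i2 : Continuous fun t => deriv γ t / (γ t - γ t₀ + I * ε * T) :=
      hdc.div (by have := hs.continuous; fun_prop) fun t => (hn t).2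
    rw [← intervalIntegral.integral_sub (i1.intervalIntegrable _ _) (i2.intervalIntegrable _ _)]
    have e3 : ∀ t, deriv γ t / (γ t - γ t₀ - I * ε * T) - deriv γ t / (γ t - γ t₀ + I * ε * T) =
        f ε t := by
      intro t
      rw [hf]
      simp only
      rw [hfac, div_sub_div _ _ (hn t).1 (hn t).2]
      congr 1
      ring
    simp only [e3]
    have hper : Function.Periodic (f ε) (2 * Real.pi) := by
      intro t
      simp only [hf, hp t, deriv_periodic hp t]
    have e4 := hper.intervalIntegral_add_eq 0 (t₀ - Real.pi)
    rw [zero_add] at e4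
    rw [e4]
    have e5 := intervalIntegral.smul_integral_comp_add_mul (f ε) (a := -(Real.pi / ε))
      (b := Real.pi / ε) ε t₀
    have e6 : t₀ + ε * -(Real.pi / ε) = t₀ - Real.pi := by
      have := hε.1.ne'
      field_simp
      ring
    have e7 : t₀ + ε * (Real.pi / ε) = t₀ - Real.pi + 2 * Real.pi := by
      have := hε.1.ne'
      field_simp
      ring
    rw [e6, e7] at e5
    rw [← e5, ← intervalIntegral.integral_smul, intervalIntegral.integral_of_le
      (by have := hε.1; have := Real.pi_pos; rw [neg_le_self_iff]; positivity)]
    rw [hg, integral_indicator measurableSet_Ioc]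
    simp only [real_smul]
  have hlim : ∫ s : ℝ, (2 * I * k / (1 + (k * s : ℝ) ^ 2 : ℂ)) = 2 * Real.pi * I := by
    have h1 := Measure.integral_comp_mul_left (fun x : ℝ => (1 + x ^ 2)⁻¹) k
    rw [integral_univ_inv_one_add_sq, abs_of_pos (inv_pos.2 hk), smul_eq_mul] at h1
    have h2 : ∀ s : ℝ, (2 * I * k / (1 + (k * s : ℝ) ^ 2 : ℂ)) =
        (2 * I * k) * (((1 + (k * s) ^ 2)⁻¹ : ℝ) : ℂ) := by
      intro s; push_cast; rw [div_eq_mul_inv]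
    simp only [h2]
    rw [integral_const_mul, integral_complex_ofReal, h1]
    have : (k : ℂ) ≠ 0 := by exact_mod_cast hk.ne'
    push_cast
    field_simp
  rw [← hlim]
  refine Tendsto.congr' (heq.mono fun _ h => h.symm) ?_
  refine tendsto_integral_filter_of_dominated_convergence (fun s => 4 * K / (1 + (c * s) ^ 2))
    ?_ ?_ ?_ ?_
  · filter_upwards [hρev] with ε hε
    refine AEStronglyMeasurable.indicator ?_ measurableSet_Ioc
    have := hfc ε hε.1 hε.2
    exact Continuous.aestronglyMeasurable (by fun_prop)
  · filter_upwards [hρev] with ε hε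
    refine Eventually.of_forall fun s => ?_
    by_cases hs' : s ∈ Ioc (-(Real.pi / ε)) (Real.pi / ε)
    · rw [hg]
      simp only
      rw [indicator_of_mem hs', hf]
      simp only
      rw [hfac]
      have hh : |ε * s| ≤ Real.pi := by
        rw [abs_mul, abs_of_pos hε.1, mul_comm, ← le_div_iff₀ hε.1, abs_le]
        exact ⟨hs'.1.le, hs'.2⟩
      have h1 := hlow _ hh
      have h2 := norm_sq_add_sq_le_of_abs_im_le hε.1 hε.2 hT (him (t₀ + ε * s))
      set A := γ (t₀ + ε * s) - γ t₀
      have h3 : ε ^ 2 * ((1 + (c * s) ^ 2) / 2) ≤ (‖A‖ ^ 2 + ε ^ 2) / 2 := by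
        have : (c * |ε * s|) ^ 2 ≤ ‖A‖ ^ 2 := by gcongr
        rw [mul_pow, sq_abs] at this
        linarith
      have h4 : ε ^ 2 * ((1 + (c * s) ^ 2) / 2) ≤ ‖A - I * ε * T‖ * ‖A + I * ε * T‖ := by
        refine abs_le_of_sq_le_sq' ?_ (by positivity) |>.2
        have h := mul_le_mul (h3.trans h2.1) (h3.trans h2.2) (by positivity) (by positivity)
        rwa [← pow_two, ← mul_pow] at h
      rw [norm_mul, norm_div, norm_mul, norm_mul (A - _)]
      have h5 : ‖2 * I * ε * T‖ = 2 * ε := by simp [hT, abs_of_pos hε.1]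
      have h6 : ‖(ε : ℂ)‖ = ε := by simp [abs_of_pos hε.1]
      rw [h5, h6]
      have hε0 := hε.1
      calc ε * (‖deriv γ (t₀ + ε * s)‖ * (2 * ε) / (‖A - I * ε * T‖ * ‖A + I * ε * T‖))
          ≤ ε * (K * (2 * ε) / (ε ^ 2 * ((1 + (c * s) ^ 2) / 2))) := by
            gcongr
            exact hK _ ⟨_, rfl⟩
        _ = _ := by field_simp; ring
    · rw [hg]
      simp only
      rw [indicator_of_notMem hs', norm_zero]
      positivity
  · have h1 := (integrable_inv_one_add_sq.comp_mul_left' hc.ne').const_mul (4 * K)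
    simpa [div_eq_mul_inv] using h1
  · refine Eventually.of_forall fun s => ?_
    have hcurve : HasDerivAt (fun ε : ℝ => γ (t₀ + ε * s)) (s * deriv γ t₀) 0 := by
      have h2 : HasDerivAt (fun ε : ℝ => t₀ + ε * s) s 0 := by
        simpa using ((hasDerivAt_id (0 : ℝ)).mul_const s).const_add t₀
      have h3 : HasDerivAt γ (deriv γ t₀) (t₀ + 0 * s) := by
        simpa using (hs.differentiable one_ne_zero t₀).hasDerivAt
      simpa [Function.comp_def] using h3.scomp 0 h2
    have hsl := hcurve.tendsto_slope_zero_right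
    simp only [zero_add, zero_mul, add_zero] at hsl
    have hdl : Tendsto (fun ε : ℝ => deriv γ (t₀ + ε * s)) (𝓝[>] 0) (𝓝 (deriv γ t₀)) := by
      have : Continuous fun ε : ℝ => deriv γ (t₀ + ε * s) := by fun_prop
      have := this.tendsto 0
      simp only [zero_mul, add_zero] at this
      exact this.mono_left nhdsWithin_le_nhds
    have hden : ((s * deriv γ t₀) ^ 2 + T ^ 2 : ℂ) = T ^ 2 * (1 + (k * s : ℝ) ^ 2) := by
      rw [hkT]; push_cast; ring
    have hden1 : (1 + (k * s : ℝ) ^ 2 : ℂ) ≠ 0 := by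
      have : (0 : ℝ) < 1 + (k * s) ^ 2 := by positivity
      exact_mod_cast this.ne'
    have hden0 : ((s * deriv γ t₀) ^ 2 + T ^ 2 : ℂ) ≠ 0 := by
      rw [hden]; exact mul_ne_zero (pow_ne_zero 2 hT0) hden1
    have hmain := (hdl.mul_const (2 * I * T)).div ((hsl.pow 2).add_const (T ^ 2)) hden0
    have hval : deriv γ t₀ * (2 * I * T) / ((s * deriv γ t₀) ^ 2 + T ^ 2) =
        2 * I * k / (1 + (k * s : ℝ) ^ 2 : ℂ) := by
      rw [hden, hkT, div_eq_div_iff (mul_ne_zero (pow_ne_zero 2 hT0) hden1) hden1]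
      ring
    rw [hval] at hmain
    refine hmain.congr' ?_
    have hIoc : ∀ᶠ ε : ℝ in 𝓝[>] 0, s ∈ Ioc (-(Real.pi / ε)) (Real.pi / ε) := by
      have : Tendsto (fun ε : ℝ => Real.pi / ε) (𝓝[>] 0) atTop := by
        simpa [div_eq_mul_inv] using tendsto_inv_nhdsGT_zero.const_mul_atTop Real.pi_pos
      filter_upwards [this.eventually_gt_atTop |s|] with ε hε
      rw [abs_lt] at hε
      exact ⟨hε.1, hε.2.le⟩
    filter_upwards [hIoc, self_mem_nhdsWithin] with ε h1 h2
    have h3 : (ε : ℂ) ≠ 0 := by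
      have : 0 < ε := h2
      exact_mod_cast this.ne'
    rw [hg]
    simp only
    rw [indicator_of_mem h1, hf]
    simp only [real_smul, ofReal_inv, Pi.div_apply]
    have h4 : ((ε : ℂ)⁻¹ * (γ (t₀ + ε * s) - γ t₀)) ^ 2 + T ^ 2 =
        ((γ (t₀ + ε * s) - γ t₀) ^ 2 + (ε * T) ^ 2) / ε ^ 2 := by
      field_simp
    rw [h4, div_div_eq_mul_div]
    ring

end PeriodicCurve

end

section

open InnerProductSpace Topology Filter

lemma exists_frontier_le_of_hasSmoothBoundary {Ω : Set ℂ} (hsm : HasSmoothBoundary Ω) :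
    ∃ ρ : ℝ, 0 < ρ ∧ ∀ p ∈ frontier Ω, ∃ (γ : ℝ → ℂ) (t₀ c k : ℝ) (T : ℂ),
      ContDiff ℝ 1 γ ∧ Function.Periodic γ (2 * Real.pi) ∧ (∀ t, γ t ∈ frontier Ω) ∧ γ t₀ = p ∧
      0 < c ∧ 0 < k ∧ ‖T‖ = 1 ∧ deriv γ t₀ = k * T ∧
      (∀ h, |h| ≤ Real.pi → c * |h| ≤ ‖γ (t₀ + h) - γ t₀‖) ∧
      ∀ q ∈ frontier Ω, 2 * ρ * |((q - p) * conj T).im| ≤ ‖q - p‖ ^ 2 := by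
  obtain ⟨-, n, γ, hs, hp, hi, hd, hdis, hfr⟩ := hsm
  have hs2 : ∀ i, ContDiff ℝ 2 (γ i) := fun i => contDiff_infty.1 (hs i) 2
  have hs1 : ∀ i, ContDiff ℝ 1 (γ i) := fun i => (hs2 i).of_le one_le_two
  choose c hc hlow using fun i => exists_mul_abs_le_norm_sub (hs1 i) (hp i) (hi i) (hd i)
  choose M hM hup using fun i => exists_norm_sub_sub_le (hs2 i) (hp i)
  have hsep : ∀ i j, ∃ δ : ℝ, 0 < δ ∧ (i ≠ j → ∀ x ∈ range (γ i), ∀ y ∈ range (γ j), δ ≤ ‖x - y‖) := by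
    intro i j
    rcases eq_or_ne i j with h | h
    · exact ⟨1, one_pos, fun h' => absurd h h'⟩
    · obtain ⟨r, hr, H⟩ := Metric.exists_pos_forall_lt_edist
        ((hp i).compact_of_continuous Real.two_pi_pos.ne' (hs i).continuous)
        ((hp j).compact_of_continuous Real.two_pi_pos.ne' (hs j).continuous).isClosed (hdis h)
      refine ⟨r, by exact_mod_cast hr, fun _ x hx y hy => ?_⟩
      have := H x hx y hy
      rw [edist_nndist, ENNReal.coe_lt_coe] at this
      rw [← dist_eq_norm, ← coe_nndist]
      exact_mod_cast this.le
  choose δ hδ hsep using hsep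
  have hev1 : ∀ᶠ ρ : ℝ in 𝓝[>] 0, ∀ i, 2 * ρ * M i ≤ c i ^ 2 := by
    rw [eventually_all]
    intro i
    have hpos : 0 < c i ^ 2 / (2 * M i) := by have := hM i; have := hc i; positivity
    filter_upwards [Ioo_mem_nhdsGT hpos] with ρ hρ
    have := hρ.2.le
    rw [le_div_iff₀ (by have := hM i; positivity)] at this
    linarith
  have hev2 : ∀ᶠ ρ : ℝ in 𝓝[>] 0, ∀ i j, 2 * ρ ≤ δ i j := by
    rw [eventually_all]
    intro i
    rw [eventually_all]
    intro j
    filter_upwards [Ioo_mem_nhdsGT (half_pos (hδ i j))] with ρ hρ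
    linarith [hρ.2]
  obtain ⟨ρ, ⟨h1, h2⟩, hρ⟩ := ((hev1.and hev2).and self_mem_nhdsWithin).exists
  have hρ : 0 < ρ := hρ
  refine ⟨ρ, hρ, fun p hpf => ?_⟩
  rw [hfr, mem_iUnion] at hpf
  obtain ⟨i, t₀, rfl⟩ := hpf
  have hk : 0 < ‖deriv (γ i) t₀‖ := norm_pos_iff.2 (hd i t₀)
  set k := ‖deriv (γ i) t₀‖ with hkdef
  have hk0 : (k : ℂ) ≠ 0 := by exact_mod_cast hk.ne'
  set T : ℂ := deriv (γ i) t₀ / k with hTdef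
  have hT : ‖T‖ = 1 := by
    rw [hTdef, norm_div, norm_real, Real.norm_eq_abs, abs_of_pos hk, ← hkdef, div_self hk.ne']
  have hkT : deriv (γ i) t₀ = k * T := by rw [hTdef]; field_simp
  refine ⟨γ i, t₀, c i, k, T, hs1 i, hp i, fun t => ?_, rfl, hc i, hk, hT, hkT, hlow i t₀, ?_⟩
  · rw [hfr]; exact mem_iUnion.2 ⟨i, t, rfl⟩
  intro q hq
  rw [hfr, mem_iUnion] at hq
  obtain ⟨j, t, rfl⟩ := hq
  rcases eq_or_ne j i with rfl | hij
  · obtain ⟨h, hh, heq⟩ : ∃ h : ℝ, |h| ≤ Real.pi ∧ γ j t = γ j (t₀ + h) := by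
      refine ⟨toIocMod Real.two_pi_pos (t₀ - Real.pi) t - t₀, ?_, ?_⟩
      · have := toIocMod_mem_Ioc Real.two_pi_pos (t₀ - Real.pi) t
        rw [abs_le]
        constructor <;> linarith [this.1, this.2]
      · have := self_sub_toIocDiv_zsmul Real.two_pi_pos (t₀ - Real.pi) t
        rw [add_sub_cancel, ← this, (hp j).sub_zsmul_eq]
    rw [heq]
    have e1 := hlow j t₀ h hh
    have e2 := hup j t₀ h
    have e3 : ((γ j (t₀ + h) - γ j t₀) * conj T).im =
        ((γ j (t₀ + h) - γ j t₀ - h * deriv (γ j) t₀) * conj T).im := by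
      have : (γ j (t₀ + h) - γ j t₀ - h * deriv (γ j) t₀) * conj T =
          (γ j (t₀ + h) - γ j t₀) * conj T - ((h * k : ℝ) : ℂ) := by
        rw [hkT]
        push_cast
        linear_combination (-h * k) * conj_mul_self_of_norm_eq_one hT
      rw [this, sub_im, ofReal_im, sub_zero]
    have e4 : |((γ j (t₀ + h) - γ j t₀) * conj T).im| ≤ M j * h ^ 2 := by
      rw [e3]
      refine (abs_im_le_norm _).trans ?_
      rwa [norm_mul_conj_of_norm_eq_one hT]
    calc 2 * ρ * |((γ j (t₀ + h) - γ j t₀) * conj T).im| ≤ 2 * ρ * (M j * h ^ 2) := by gcongr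
      _ = 2 * ρ * M j * h ^ 2 := by ring
      _ ≤ c j ^ 2 * h ^ 2 := by gcongr; exact h1 j
      _ = (c j * |h|) ^ 2 := by rw [mul_pow, sq_abs]
      _ ≤ _ := by have := hc j; gcongr
  · have e1 := hsep j i hij _ ⟨t, rfl⟩ _ ⟨t₀, rfl⟩
    have e2 := (abs_im_le_norm ((γ j t - γ i t₀) * conj T))
    rw [norm_mul_conj_of_norm_eq_one hT] at e2
    have e3 := h2 j i
    calc _ ≤ 2 * ρ * ‖γ j t - γ i t₀‖ := by gcongr
      _ ≤ ‖γ j t - γ i t₀‖ * ‖γ j t - γ i t₀‖ := by gcongr; linarith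
      _ = _ := by ring

/-- Smoothly bounded domains have tangent discs of uniform radius at the boundary. -/
lemma exists_tangentBalls {Ω : Set ℂ} (ho : IsOpen Ω) (hcon : IsPreconnected Ω)
    (hsm : HasSmoothBoundary Ω) :
    ∃ ρ : ℝ, 0 < ρ ∧ ∀ p ∈ frontier Ω, ∃ T, TangentBalls Ω ρ p T := by
  obtain ⟨ρ, hρ, H⟩ := exists_frontier_le_of_hasSmoothBoundary hsm
  refine ⟨ρ, hρ, fun p hpf => ?_⟩
  obtain ⟨γ, t₀, c, k, T, hs, hp, hγ, rfl, hc, hk, hT, hkT, hlow, hle⟩ := H p hpf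
  have hmul : ∀ w : ℂ, (γ t₀ + T * w - γ t₀) * conj T = w := by
    intro w
    linear_combination w * conj_mul_self_of_norm_eq_one hT
  have hside : ∀ U : ℂ, ‖U‖ = 1 → (∀ q ∈ frontier Ω, 2 * ρ * |((q - γ t₀) * conj U).im| ≤
      ‖q - γ t₀‖ ^ 2) → ¬ TangentBalls Ω ρ (γ t₀) U →
      ∀ ε : ℝ, 0 < ε → ε < 2 * ρ → γ t₀ - I * ε * U ∈ Ω := by
    intro U hU hleU hnot ε hε hε2
    by_contra hmem
    refine hnot ⟨hU, hleU, fun z hz => ?_⟩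
    by_contra! hlt
    have hmulU : ∀ w : ℂ, (γ t₀ + U * w - γ t₀) * conj U = w := by
      intro w
      linear_combination w * conj_mul_self_of_norm_eq_one hU
    have hpre : IsPreconnected ((fun w => γ t₀ + U * -w) '' ball (I * (ρ : ℂ)) ρ) :=
      (convex_ball _ _).isPreconnected.image _ (by fun_prop)
    have hsub := hpre.subset_of_disjoint_frontier ho ?_ ⟨z, ⟨-((z - γ t₀) * conj U), ?_, ?_⟩, hz⟩
    · apply hmem
      apply hsub
      refine ⟨I * ε, ?_, by ring⟩
      rw [mem_ball_I_mul_iff hρ]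
      simp [abs_of_pos hε]
      nlinarith
    · rw [disjoint_left]
      rintro _ ⟨y, hy, rfl⟩ hf
      have h1 := hleU _ hf
      rw [← norm_mul_conj_of_norm_eq_one hU, hmulU] at h1
      rw [mem_ball_I_mul_iff hρ] at hy
      rw [norm_neg, neg_im, abs_neg] at h1
      have := le_abs_self y.im
      nlinarith
    · rw [mem_ball_I_mul_iff hρ, norm_neg, norm_mul_conj_of_norm_eq_one hU, neg_im]
      linarith
    · linear_combination (z - γ t₀) * conj_mul_self_of_norm_eq_one hU
  by_contra! hnone
  have hm := hside T hT hle (hnone T)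
  have hpl := hside (-T) (by rwa [norm_neg]) (fun q hq => by
    rw [map_neg, mul_neg, neg_im, abs_neg]; exact hle q hq) (hnone (-T))
  have hlim := tendsto_integral_deriv_div_sub_sub hs hp hc hρ hk hT hkT hlow
    (fun t => hle _ (hγ t))
  have hzero : Tendsto (fun ε : ℝ =>
      (∫ t in (0 : ℝ)..2 * Real.pi, deriv γ t / (γ t - (γ t₀ + I * ε * T))) -
      ∫ t in (0 : ℝ)..2 * Real.pi, deriv γ t / (γ t - (γ t₀ - I * ε * T))) (𝓝[>] 0) (𝓝 0) := by
    refine tendsto_const_nhds.congr' ?_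
    filter_upwards [Ioo_mem_nhdsGT (show (0 : ℝ) < 2 * ρ by positivity)] with ε hε
    rw [integral_deriv_div_sub_eq hs hp ho hcon
      (fun t h => (hγ t).2 (by rwa [ho.interior_eq])) (a := γ t₀ + I * ε * T)
      (b := γ t₀ - I * ε * T) (by simpa using hpl ε hε.1 hε.2) (hm ε hε.1 hε.2), sub_self]
  have := tendsto_nhds_unique hlim hzero
  have hpi : (Real.pi : ℂ) ≠ 0 := by exact_mod_cast Real.pi_ne_zero
  simp [hpi] at this

lemma TangentBalls.mem_closure_compl {Ω : Set ℂ} {ρ : ℝ} {p T : ℂ} (hρ : 0 < ρ)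
    (h : TangentBalls Ω ρ p T) : p ∈ closure (closure Ω)ᶜ := by
  have hlim : Tendsto (fun ε : ℝ => p - I * ε * T) (𝓝[>] 0) (𝓝 p) := by
    have : Continuous fun ε : ℝ => p - I * ε * T := by fun_prop
    have := this.tendsto 0
    simp only [ofReal_zero, mul_zero, zero_mul, sub_zero] at this
    exact this.mono_left nhdsWithin_le_nhds
  refine mem_closure_of_tendsto hlim ?_
  filter_upwards [Ioo_mem_nhdsGT (show (0 : ℝ) < 2 * ρ by positivity)] with ε hε hcl
  have h1 := h.le_of_mem_closure _ hcl
  have h2 : (p - I * ε * T - p) * conj T = -(I * ε) := by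
    linear_combination (-I * ε) * conj_mul_self_of_norm_eq_one h.norm_eq_one
  rw [← norm_mul_conj_of_norm_eq_one h.norm_eq_one, h2] at h1
  have hε1 := hε.1
  simp [abs_of_pos hε1] at h1
  nlinarith [hε.2]

end

section

open InnerProductSpace Topology Filter

lemma integrableOn_ball_norm_inv (r : ℝ) :
    IntegrableOn (fun z : ℂ => ‖z‖⁻¹) (ball (0 : ℂ) r) := by
  refine (integrableOn_fun_norm_addHaar volume (f := fun y : ℝ => y⁻¹)).2 ?_
  refine (integrableOn_const (C := (1 : ℝ)) (by simp)).congr_fun (fun y hy => ?_) measurableSet_Ioo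
  simp [Complex.finrank_real_complex, hy.1.ne']

lemma integrableOn_inv_sub {s : Set ℂ} (hs : Bornology.IsBounded s) (a : ℂ) :
    IntegrableOn (fun z : ℂ => (z - a)⁻¹) s := by
  obtain ⟨r, hr⟩ := hs.subset_ball a
  refine IntegrableOn.mono_set ?_ hr
  have h : IntegrableOn (fun z : ℂ => z⁻¹) (ball (0 : ℂ) r) :=
    (integrableOn_ball_norm_inv r).mono' (by fun_prop) (Eventually.of_forall fun z => by simp)
  have h2 := ((measurePreserving_sub_right (volume : Measure ℂ) a).integrableOn_comp_preimage
    (MeasurableEquiv.subRight a).measurableEmbedding).2 h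
  have h3 : (fun x => x - a) ⁻¹' ball (0 : ℂ) r = ball a r := by
    ext x; simp [dist_eq_norm]
  rwa [h3] at h2

lemma circleAverage_inv_sub_of_lt {a : ℂ} {x : ℝ} (hx : 0 < x) (h : x < ‖a‖) :
    Real.circleAverage (fun z : ℂ => (z - a)⁻¹) 0 x = -a⁻¹ := by
  rw [DiffContOnCl.circleAverage]
  · simp [inv_neg]
  · rw [abs_of_pos hx]
    refine DifferentiableOn.diffContOnCl_ball (U := ball 0 ‖a‖) ?_ (closedBall_subset_ball h)
    intro z hz
    refine ((differentiableAt_id.sub_const a).inv ?_).differentiableWithinAt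
    rintro h0
    rw [sub_eq_zero] at h0
    simp [← h0] at hz

lemma circleAverage_inv_sub_of_gt {a : ℂ} (ha : a ≠ 0) {x : ℝ} (h : ‖a‖ < x) :
    Real.circleAverage (fun z : ℂ => (z - a)⁻¹) 0 x = 0 := by
  have hx : 0 < x := (norm_nonneg a).trans_lt h
  have h1 : Real.circleAverage (fun z : ℂ => ((z - 0) / (z - a)) • (1 : ℂ)) 0 x = 1 :=
    DiffContOnCl.circleAverage_smul_div (f := fun _ => (1 : ℂ)) diffContOnCl_const
      (by rwa [abs_of_pos hx, mem_ball_zero_iff])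
  have hne : ∀ z ∈ sphere (0 : ℂ) |x|, z - a ≠ 0 := by
    rintro z hz h0
    rw [sub_eq_zero] at h0
    rw [abs_of_pos hx, h0, mem_sphere_zero_iff_norm] at hz
    exact h.ne hz
  have hi : CircleIntegrable (fun z : ℂ => a⁻¹ • ((z - 0) / (z - a)) • (1 : ℂ)) 0 x := by
    refine ContinuousOn.circleIntegrable' fun z hz => ContinuousAt.continuousWithinAt ?_
    have := hne z hz
    fun_prop (disch := assumption)
  have h2 : Real.circleAverage
      (fun z : ℂ => a⁻¹ • ((z - 0) / (z - a)) • (1 : ℂ) - (fun _ => a⁻¹) z) 0 x = 0 := by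
    rw [Real.circleAverage_fun_sub hi (circleIntegrable_const _ _ _),
      Real.circleAverage_fun_smul, h1, Real.circleAverage_const, smul_eq_mul, mul_one, sub_self]
  refine Eq.trans (Real.circleAverage_congr_sphere fun z hz => ?_) h2
  have := hne z hz
  simp only [sub_zero, smul_eq_mul, mul_one]
  field_simp
  ring

lemma setIntegral_ball_inv_sub {r : ℝ} {a : ℂ} (ha : a ∈ ball (0 : ℂ) r) :
    ∫ z in ball (0 : ℂ) r, (z - a)⁻¹ = -(Real.pi : ℂ) * conj a := by
  rcases eq_or_ne a 0 with rfl | ha0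
  · have h1 : ∫ z in ball (0 : ℂ) r, (z - 0)⁻¹ = ∫ z : ℂ, (ball (0 : ℂ) r).indicator (·⁻¹) z := by
      rw [integral_indicator measurableSet_ball]; simp
    have h2 := integral_neg_eq_self ((ball (0 : ℂ) r).indicator (·⁻¹)) volume
    have h3 : ∀ z : ℂ, (ball (0 : ℂ) r).indicator (·⁻¹) (-z) = -(ball (0 : ℂ) r).indicator (·⁻¹) z := by
      intro z
      simp only [indicator, mem_ball_zero_iff, norm_neg, inv_neg]
      split_ifs <;> simp
    simp only [h3, integral_neg] at h2
    rw [h1]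
    rw [map_zero, mul_zero]
    exact self_eq_neg.1 h2.symm
  rw [mem_ball_zero_iff] at ha
  set f : ℂ → ℂ := (ball (0 : ℂ) r).indicator fun z => (z - a)⁻¹ with hf
  have hfi : Integrable f :=
    (integrable_indicator_iff measurableSet_ball).2 (integrableOn_inv_sub isBounded_ball a)
  have hfm : Measurable f := Measurable.indicator (by fun_prop) measurableSet_ball
  have hsm : Measurable (Complex.polarCoord.symm : ℝ × ℝ → ℂ) := by
    have : (Complex.polarCoord.symm : ℝ × ℝ → ℂ) =
        fun p => p.1 * (Real.cos p.2 + Real.sin p.2 * Complex.I) := by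
      ext p; exact Complex.polarCoord_symm_apply p
    rw [this]; fun_prop
  rw [← integral_indicator measurableSet_ball, ← Complex.integral_comp_polarCoord_symm]
  have hIntOn : IntegrableOn (fun p : ℝ × ℝ => p.1 • f (Complex.polarCoord.symm p))
      polarCoord.target := by
    refine ⟨(measurable_fst.smul (hfm.comp hsm)).aestronglyMeasurable, ?_⟩
    have := hfi.2
    rw [HasFiniteIntegral, ← Complex.lintegral_comp_polarCoord_symm] at this
    rw [HasFiniteIntegral]
    refine lt_of_eq_of_lt (setLIntegral_congr_fun polarCoord.open_target.measurableSet
      (fun p hp => ?_)) this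
    have hp1 : 0 < p.1 := hp.1
    simp only [enorm_smul, smul_eq_mul]
    rw [Real.enorm_eq_ofReal hp1.le]
  rw [polarCoord_target] at hIntOn ⊢
  rw [Measure.volume_eq_prod] at hIntOn ⊢
  rw [setIntegral_prod _ hIntOn]
  have key : ∀ x ∈ Ioi (0 : ℝ), x ≠ ‖a‖ → ∫ y in Ioo (-Real.pi) Real.pi,
      x • f (Complex.polarCoord.symm (x, y)) =
      (Ioo 0 ‖a‖).indicator (fun x : ℝ => (-(2 * Real.pi * a⁻¹) : ℂ) * x) x := by
    intro x hx hxa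
    rw [← integral_Ioc_eq_integral_Ioo, ← intervalIntegral.integral_of_le (by linarith [Real.pi_pos])]
    by_cases hxr : x < r
    · have h1 : ∫ y in (-Real.pi)..Real.pi, x • f (Complex.polarCoord.symm (x, y)) =
          (x * (2 * Real.pi)) • Real.circleAverage (fun z : ℂ => (z - a)⁻¹) 0 x := by
        rw [Real.circleAverage_eq_integral_add (-Real.pi), smul_smul,
          mul_assoc, mul_inv_cancel₀ (by positivity), mul_one,
          intervalIntegral.integral_comp_add_right
            (fun θ => (circleMap 0 x θ - a)⁻¹), intervalIntegral.integral_smul]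
        congr 1
        rw [show (0 : ℝ) + -Real.pi = -Real.pi by ring, show 2 * Real.pi + -Real.pi = Real.pi by ring]
        refine intervalIntegral.integral_congr fun y _ => ?_
        have : Complex.polarCoord.symm (x, y) = circleMap 0 x y := by
          rw [Complex.polarCoord_symm_apply, circleMap, zero_add, Complex.exp_mul_I]
          simp
        rw [this, hf]
        refine indicator_of_mem (s := ball (0 : ℂ) r) ?_ _
        rw [mem_ball_zero_iff, norm_circleMap_zero, abs_of_pos hx]
        exact hxr
      rw [h1]
      rcases lt_or_gt_of_ne hxa with h | h
      · rw [indicator_of_mem (show x ∈ Ioo 0 ‖a‖ from ⟨hx, h⟩), circleAverage_inv_sub_of_lt hx h]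
        rw [Complex.real_smul]; push_cast; ring
      · rw [indicator_of_notMem (fun h' => h.not_gt h'.2), circleAverage_inv_sub_of_gt ha0 h,
          smul_zero]
    · rw [indicator_of_notMem (fun h' => hxr (h'.2.trans ha))]
      refine (intervalIntegral.integral_congr (g := fun _ => (0 : ℂ)) fun y _ => ?_).trans (by simp)
      have : f (Complex.polarCoord.symm (x, y)) = 0 := by
        refine indicator_of_notMem ?_ _
        rw [mem_ball_zero_iff, Complex.norm_polarCoord_symm, abs_of_pos hx]
        exact hxr
      simp only [this, smul_zero]
  have hae : ∀ᵐ x ∂(volume.restrict (Ioi (0 : ℝ))), ∫ y in Ioo (-Real.pi) Real.pi,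
      x • f (Complex.polarCoord.symm (x, y)) =
      (Ioo 0 ‖a‖).indicator (fun x : ℝ => (-(2 * Real.pi * a⁻¹) : ℂ) * x) x := by
    have h0 : ∀ᵐ x : ℝ ∂(volume.restrict (Ioi (0 : ℝ))), x ≠ ‖a‖ :=
      ae_restrict_of_ae (by simp [ae_iff])
    filter_upwards [h0, ae_restrict_mem measurableSet_Ioi] with x h1 h2
    exact key x h2 h1
  rw [integral_congr_ae hae, setIntegral_indicator measurableSet_Ioo,
    inter_eq_self_of_subset_right (fun x hx => hx.1), ← integral_Ioc_eq_integral_Ioo,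
    ← intervalIntegral.integral_of_le (norm_nonneg a), intervalIntegral.integral_const_mul,
    intervalIntegral.integral_ofReal, integral_id]
  have : (‖a‖ : ℂ) ^ 2 = a * conj a := by rw [mul_conj, normSq_eq_norm_sq]; push_cast; rfl
  push_cast
  rw [this]
  field_simp
  ring

end

section

open InnerProductSpace Topology Filter

lemma volume_frontier_eq_zero_of_hasSmoothBoundary {Ω : Set ℂ} (hsm : HasSmoothBoundary Ω) :
    volume (frontier Ω) = 0 := by
  obtain ⟨-, n, γ, hs, -, -, -, -, hfr⟩ := hsm
  rw [hfr, measure_iUnion_null_iff]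
  intro i
  have h1 : dimH (range (γ i)) ≤ (Module.finrank ℝ ℝ : ENNReal) :=
    (contDiff_infty.1 (hs i) 1).dimH_range_le
  have h2 : (volume : Measure ℂ) ≪ μH[((2 : NNReal) : ℝ)] := by
    have : (volume : Measure ℂ) ≪ μH[(Module.finrank ℝ ℂ : ℝ)] := Measure.absolutelyContinuous_isAddHaarMeasure _ _
    simpa [Complex.finrank_real_complex] using this
  refine measure_zero_of_dimH_lt h2 (h1.trans_lt ?_)
  rw [Module.finrank_self]
  norm_num

/-- The Cauchy transform of the indicator function of `Ω`. -/
def cauchyTransform (Ω : Set ℂ) (ζ : ℂ) : ℂ := ∫ z in Ω, (z - ζ)⁻¹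

lemma continuous_cauchyTransform {Ω : Set ℂ} (ho : IsOpen Ω) (hb : Bornology.IsBounded Ω)
    (h0 : volume (frontier Ω) = 0) : Continuous (cauchyTransform Ω) := by
  have heq : ∀ ζ, cauchyTransform Ω ζ = ∫ w, Ω.indicator (fun _ => w⁻¹) (w + ζ) := by
    intro ζ
    rw [cauchyTransform, ← integral_indicator ho.measurableSet,
      ← integral_add_right_eq_self _ ζ]
    refine integral_congr_ae (Eventually.of_forall fun w => ?_)
    simp only [indicator]
    rw [add_sub_cancel_right]
  obtain ⟨R, hR⟩ := hb.subset_ball 0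
  refine continuous_iff_continuousAt.2 fun ζ₀ => ?_
  rw [show cauchyTransform Ω = _ from funext heq]
  refine continuousAt_of_dominated
    (bound := (ball (0 : ℂ) (R + ‖ζ₀‖ + 1)).indicator fun w => ‖w‖⁻¹) ?_ ?_ ?_ ?_
  · refine Eventually.of_forall fun ζ => Measurable.aestronglyMeasurable ?_
    simp only [indicator]
    exact Measurable.ite (ho.measurableSet.preimage (by fun_prop)) (by fun_prop) measurable_const
  · filter_upwards [ball_mem_nhds ζ₀ one_pos] with ζ hζ
    refine Eventually.of_forall fun w => ?_
    by_cases hw : w + ζ ∈ Ω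
    · have h1 : ‖w + ζ‖ < R := by simpa using hR hw
      rw [mem_ball, dist_eq_norm] at hζ
      have h2 : w = (w + ζ) - (ζ - ζ₀) - ζ₀ := by ring
      have h3 : ‖w‖ < R + ‖ζ₀‖ + 1 := by
        rw [h2]
        linarith [norm_sub_le ((w + ζ) - (ζ - ζ₀)) ζ₀, norm_sub_le (w + ζ) (ζ - ζ₀)]
      rw [indicator_of_mem hw, indicator_of_mem (by simpa using h3), norm_inv]
    · rw [indicator_of_notMem hw, norm_zero]
      exact indicator_nonneg (fun _ _ => by positivity) _
  · exact (integrable_indicator_iff measurableSet_ball).2 (integrableOn_ball_norm_inv _)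
  · have hae : ∀ᵐ w : ℂ, w + ζ₀ ∉ frontier Ω := by
      rw [ae_iff]
      simp only [not_not]
      exact (measurePreserving_add_right (volume : Measure ℂ) ζ₀).quasiMeasurePreserving.preimage_null h0
    filter_upwards [hae] with w hw
    have hcont : ContinuousAt (fun ζ => w + ζ) ζ₀ := by fun_prop
    by_cases h : w + ζ₀ ∈ Ω
    · refine continuousAt_const.congr (f := fun _ => w⁻¹) ?_
      filter_upwards [hcont (ho.mem_nhds h)] with ζ hζ
      exact (indicator_of_mem (s := Ω) hζ fun _ => w⁻¹).symm
    · have hc : w + ζ₀ ∉ closure Ω := fun h' => hw ⟨h', by rwa [ho.interior_eq]⟩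
      refine continuousAt_const.congr (f := fun _ => (0 : ℂ)) ?_
      filter_upwards [hcont (isClosed_closure.isOpen_compl.mem_nhds hc)] with ζ hζ
      exact (indicator_of_notMem (s := Ω) (fun h' => hζ (subset_closure h')) fun _ => w⁻¹).symm

lemma differentiableOn_cauchyTransform_of_disjoint {E : Set ℂ} {c : ℂ} {r : ℝ}
    (hE : MeasurableSet E) (hb : Bornology.IsBounded E) (hd : Disjoint E (ball c r)) :
    DifferentiableOn ℂ (cauchyTransform E) (ball c r) := by
  intro ζ₀ hζ₀
  obtain ⟨ε, hε, hsub⟩ := Metric.isOpen_iff.1 isOpen_ball ζ₀ hζ₀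
  have hfar : ∀ z ∈ E, ∀ ζ ∈ ball ζ₀ (ε / 2), ε / 2 ≤ ‖z - ζ‖ := by
    intro z hz ζ hζ
    by_contra! hlt
    refine disjoint_left.1 hd hz (hsub ?_)
    rw [← dist_eq_norm] at hlt
    rw [mem_ball] at hζ ⊢
    linarith [dist_triangle z ζ ζ₀]
  refine (hasDerivAt_integral_of_dominated_loc_of_deriv_le
    (F := fun ζ z => (z - ζ)⁻¹) (F' := fun ζ z => ((z - ζ) ^ 2)⁻¹)
    (bound := fun _ => ((ε / 2) ^ 2)⁻¹) (ball_mem_nhds ζ₀ (half_pos hε)) ?_ ?_ ?_ ?_ ?_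
    ?_).2.differentiableAt.differentiableWithinAt
  · exact Eventually.of_forall fun ζ => by fun_prop
  · exact integrableOn_inv_sub hb ζ₀
  · fun_prop
  · filter_upwards [ae_restrict_mem hE] with z hz ζ hζ
    rw [norm_inv, norm_pow]
    have := hfar z hz ζ hζ
    gcongr
  · exact integrableOn_const hb.measure_lt_top.ne
  · filter_upwards [ae_restrict_mem hE] with z hz ζ hζ
    have h1 : z - ζ ≠ 0 := by
      have := hfar z hz ζ hζ
      rw [← norm_pos_iff]; linarith [half_pos hε]
    have := ((hasDerivAt_id ζ).const_sub z).fun_inv h1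
    simpa using this

lemma cauchyTransform_ball {c ζ : ℂ} {r : ℝ} (hζ : ζ ∈ ball c r) :
    cauchyTransform (ball c r) ζ = -(Real.pi : ℂ) * conj (ζ - c) := by
  rw [← setIntegral_ball_inv_sub (r := r) (by simpa [dist_eq_norm] using hζ), cauchyTransform,
    ← integral_indicator measurableSet_ball, ← integral_indicator measurableSet_ball,
    ← integral_add_right_eq_self _ c]
  refine integral_congr_ae (Eventually.of_forall fun w => ?_)
  simp only [indicator, mem_ball, dist_eq_norm, add_sub_cancel_right, sub_zero]
  rw [show w + c - ζ = w - (ζ - c) by ring]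

lemma differentiableOn_conj_add_cauchyTransform {Ω : Set ℂ} (ho : IsOpen Ω)
    (hb : Bornology.IsBounded Ω) :
    DifferentiableOn ℂ (fun ζ => conj ζ + cauchyTransform Ω ζ / Real.pi) Ω := by
  intro c hc
  obtain ⟨r, hr, hsub⟩ := Metric.isOpen_iff.1 ho c hc
  have hd := differentiableOn_cauchyTransform_of_disjoint (c := c) (r := r)
    (ho.measurableSet.diff measurableSet_ball) (hb.subset sdiff_subset) disjoint_sdiff_left
  have hd' : DifferentiableOn ℂ (fun ζ => conj c + cauchyTransform (Ω \ ball c r) ζ / Real.pi)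
      (ball c r) := (hd.div_const _).const_add _
  refine ((hd'.differentiableAt (ball_mem_nhds c hr)).congr_of_eventuallyEq
    ?_).differentiableWithinAt
  filter_upwards [ball_mem_nhds c hr] with ζ hζ
  have h1 : cauchyTransform Ω ζ = cauchyTransform (Ω \ ball c r) ζ + cauchyTransform (ball c r) ζ := by
    have hI := integrableOn_inv_sub hb ζ
    rw [cauchyTransform, cauchyTransform, cauchyTransform, ← setIntegral_union disjoint_sdiff_left measurableSet_ball
      (hI.mono_set sdiff_subset) (hI.mono_set hsub), sdiff_union_of_subset hsub]
  rw [h1, cauchyTransform_ball hζ, map_sub]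
  have : (Real.pi : ℂ) ≠ 0 := by exact_mod_cast Real.pi_ne_zero
  field_simp
  ring

lemma exists_polynomial_mul_sum_eq {ι : Type*} {Ω : Set ℂ} (t : Finset ι) (R : ι → ℂ → ℂ)
    (h : ∀ i ∈ t, ∃ p q : Polynomial ℂ, (∀ z, q.eval z = 0 → z ∈ Ω) ∧ q ≠ 0 ∧
      ∀ z ∉ Ω, R i z * q.eval z = p.eval z) :
    ∃ p q : Polynomial ℂ, (∀ z, q.eval z = 0 → z ∈ Ω) ∧ q ≠ 0 ∧
      ∀ z ∉ Ω, (∑ i ∈ t, R i z) * q.eval z = p.eval z := by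
  classical
  induction t using Finset.induction_on with
  | empty => exact ⟨0, 1, by simp, one_ne_zero, by simp⟩
  | insert i t hi ih =>
    obtain ⟨p₁, q₁, h₁, hn₁, e₁⟩ := h i (Finset.mem_insert_self _ _)
    obtain ⟨p₂, q₂, h₂, hn₂, e₂⟩ := ih fun j hj => h j (Finset.mem_insert_of_mem hj)
    refine ⟨p₁ * q₂ + p₂ * q₁, q₁ * q₂, fun z hz => ?_, mul_ne_zero hn₁ hn₂, fun z hz => ?_⟩
    · rw [Polynomial.eval_mul, mul_eq_zero] at hz
      exact hz.elim (h₁ z) (h₂ z)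
    · rw [Finset.sum_insert hi, Polynomial.eval_mul, Polynomial.eval_add, Polynomial.eval_mul,
        Polynomial.eval_mul, ← e₁ z hz, ← e₂ z hz]
      ring

lemma bergmanFun_inv_sub {Ω : Set ℂ} (ho : IsOpen Ω) (hA : volume Ω < ⊤) {ζ : ℂ}
    (hζ : ζ ∉ closure Ω) : BergmanFun Ω fun z => (z - ζ)⁻¹ := by
  obtain ⟨ε, hε, hsub⟩ := Metric.isOpen_iff.1 isClosed_closure.isOpen_compl ζ hζ
  have hfar : ∀ z ∈ Ω, ε ≤ ‖z - ζ‖ := by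
    intro z hz
    by_contra! hlt
    rw [← dist_eq_norm] at hlt
    exact hsub hlt (subset_closure hz)
  have hdiff : DifferentiableOn ℂ (fun z => (z - ζ)⁻¹) Ω := by
    refine (differentiableOn_id.sub_const ζ).inv fun z hz => ?_
    rw [← norm_pos_iff]
    exact hε.trans_le (hfar z hz)
  refine ⟨hdiff, ?_⟩
  refine (integrableOn_const (C := ((ε⁻¹) ^ 2)) hA.ne).mono'
    ((hdiff.continuousOn.norm.pow 2).aestronglyMeasurable ho.measurableSet) ?_
  filter_upwards [ae_restrict_mem ho.measurableSet] with z hz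
  have := hfar z hz
  rw [norm_pow, norm_norm, norm_inv]
  gcongr

lemma iteratedDerivWithin_inv_sub {Ω : Set ℂ} (ho : IsOpen Ω) {w : ℂ} (hw : w ∈ Ω) (ζ : ℂ)
    (k : ℕ) : iteratedDerivWithin k (fun z => (z - ζ)⁻¹) Ω w =
      (-1) ^ k * (Nat.factorial k) * ((w - ζ) ^ (k + 1))⁻¹ := by
  rw [iteratedDerivWithin_of_isOpen ho hw, iteratedDeriv_eq_iterate]
  have := congrFun (iter_deriv_inv_linear_sub k (1 : ℂ) ζ) w
  simp only [one_mul, one_pow, mul_one] at this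
  rw [this, show (-1 - k : ℤ) = -((k + 1 : ℕ) : ℤ) by push_cast; ring, zpow_neg, zpow_natCast]

lemma exists_polynomial_mul_cauchyTransform_eq {Ω : Set ℂ} (ho : IsOpen Ω) (hA : volume Ω < ⊤)
    (hq : IsQuadratureDomain Ω) :
    ∃ p q : Polynomial ℂ, (∀ z, q.eval z = 0 → z ∈ Ω) ∧ q ≠ 0 ∧
      ∀ z ∉ closure Ω, cauchyTransform Ω z * q.eval z = p.eval z := by
  obtain ⟨N, -, w, n, c, hw, H⟩ := hq
  obtain ⟨p, q, h, hn, e⟩ := exists_polynomial_mul_sum_eq (Ω := Ω) Finset.univ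
    (fun (j : Fin N) z => ∑ k ∈ Finset.range (n j + 1),
      c j k * ((-1) ^ k * (Nat.factorial k) * ((w j - z) ^ (k + 1))⁻¹)) fun j _ => by
    refine exists_polynomial_mul_sum_eq _ _ fun k _ => ⟨Polynomial.C (c j k * ((-1) ^ k *
      (Nat.factorial k))), (Polynomial.C (w j) - Polynomial.X) ^ (k + 1), fun z hz => ?_, ?_,
      fun z hz => ?_⟩
    · have h0 : w j - z = 0 := by simpa using hz
      rw [← sub_eq_zero.1 h0]
      exact hw j
    · refine pow_ne_zero _ fun h0 => ?_
      have := congrArg (Polynomial.eval (w j - 1)) h0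
      simp at this
    · have h0 : w j - z ≠ 0 := fun h0 => hz (sub_eq_zero.1 h0 ▸ hw j)
      simp only [Polynomial.eval_pow, Polynomial.eval_sub, Polynomial.eval_C, Polynomial.eval_X]
      field_simp
  refine ⟨p, q, h, hn, fun z hz => ?_⟩
  rw [← e z fun hz' => hz (subset_closure hz'), cauchyTransform, H _ (bergmanFun_inv_sub ho hA hz)]
  congr 1
  refine Finset.sum_congr rfl fun j _ => Finset.sum_congr rfl fun k _ => ?_
  rw [iteratedDerivWithin_inv_sub ho (hw j)]

/-- The boundary values `conj z` of a quadrature domain continue to a meromorphic function with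
polynomial denominator. -/
lemma exists_schwarz_function {Ω : Set ℂ} (ho : IsOpen Ω) (hA : volume Ω < ⊤)
    (hb : Bornology.IsBounded Ω) (hq : IsQuadratureDomain Ω) (h0 : volume (frontier Ω) = 0)
    (hcl : ∀ p ∈ frontier Ω, p ∈ closure (closure Ω)ᶜ) :
    ∃ (q : Polynomial ℂ) (s : ℂ → ℂ), q ≠ 0 ∧ (∀ z, q.eval z = 0 → z ∈ Ω) ∧ Continuous s ∧
      DifferentiableOn ℂ s Ω ∧ ∀ z ∈ frontier Ω, s z = conj z * q.eval z := by
  obtain ⟨p, q, h, hn, e⟩ := exists_polynomial_mul_cauchyTransform_eq ho hA hq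
  have hC := continuous_cauchyTransform ho hb h0
  have hpi : (Real.pi : ℂ) ≠ 0 := by exact_mod_cast Real.pi_ne_zero
  refine ⟨q, fun z => (conj z + cauchyTransform Ω z / Real.pi) * q.eval z - p.eval z / Real.pi,
    hn, h, ?_, ?_, fun z hz => ?_⟩
  · have := q.continuous
    have := p.continuous
    fun_prop
  · exact ((differentiableOn_conj_add_cauchyTransform ho hb).mul
      q.differentiable.differentiableOn).sub (p.differentiable.differentiableOn.div_const _)
  · have hcl' : closure (closure Ω)ᶜ ⊆ {z | cauchyTransform Ω z * q.eval z = p.eval z} :=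
      closure_minimal e (isClosed_eq (hC.mul q.continuous) p.continuous)
    have : cauchyTransform Ω z * q.eval z = p.eval z := hcl' (hcl z hz)
    simp only
    rw [← this]
    field_simp
    ring

end

section

open InnerProductSpace Topology Filter

/-- The filter of points of `Ω` approaching `frontier Ω`. -/
def innerBoundary (Ω : Set ℂ) : Filter ℂ := 𝓝ˢ (frontier Ω) ⊓ 𝓟 Ω

lemma eventually_innerBoundary_of_isOpen {Ω U : Set ℂ} (hU : IsOpen U) (h : frontier Ω ⊆ U) :
    ∀ᶠ z in innerBoundary Ω, z ∈ U :=
  mem_inf_of_left (hU.mem_nhdsSet.2 h)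

lemma eventually_mem_innerBoundary (Ω : Set ℂ) : ∀ᶠ z in innerBoundary Ω, z ∈ Ω :=
  mem_inf_of_right (mem_principal_self Ω)

lemma nhdsWithin_le_innerBoundary {Ω : Set ℂ} {p : ℂ} (hp : p ∈ frontier Ω) :
    𝓝[Ω] p ≤ innerBoundary Ω :=
  inf_le_inf_right _ (nhds_le_nhdsSet hp)

lemma tendsto_innerBoundary_zero {Ω : Set ℂ} {f : ℂ → ℂ} (h : ∀ p ∈ frontier Ω, ContinuousAt f p)
    (h0 : ∀ p ∈ frontier Ω, f p = 0) : Tendsto f (innerBoundary Ω) (𝓝 0) := by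
  refine Tendsto.mono_left (fun V hV => ?_) (inf_le_left : innerBoundary Ω ≤ 𝓝ˢ (frontier Ω))
  rw [Filter.mem_map, mem_nhdsSet_iff_forall]
  intro p hp
  exact h p hp (by rwa [h0 p hp])

lemma tendsto_infDist_innerBoundary (Ω : Set ℂ) :
    Tendsto (fun z => infDist z (frontier Ω)) (innerBoundary Ω) (𝓝 0) := by
  refine Tendsto.mono_left (fun V hV => ?_) (inf_le_left : innerBoundary Ω ≤ 𝓝ˢ (frontier Ω))
  rw [Filter.mem_map, mem_nhdsSet_iff_forall]
  intro p hp
  exact (continuous_infDist_pt (frontier Ω)).continuousAt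
    (by rwa [infDist_zero_of_mem hp])

lemma exists_nearest_frontier {Ω : Set ℂ} (ho : IsOpen Ω) (hne : (frontier Ω).Nonempty) {z : ℂ}
    (hz : z ∈ Ω) : ∃ p ∈ frontier Ω, ‖z - p‖ = infDist z (frontier Ω) ∧ 0 < ‖z - p‖ ∧
      ball z ‖z - p‖ ⊆ Ω := by
  obtain ⟨p, hp, h⟩ := isClosed_frontier.exists_infDist_eq_dist hne z
  rw [dist_eq_norm] at h
  have hpos : 0 < ‖z - p‖ := by
    rw [norm_pos_iff, sub_ne_zero]
    rintro rfl
    exact hp.2 (by rwa [ho.interior_eq])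
  refine ⟨p, hp, h.symm, hpos, ?_⟩
  refine IsPreconnected.subset_of_disjoint_frontier (convex_ball z _).isPreconnected ho ?_
    ⟨z, mem_ball_self hpos, hz⟩
  rw [← h]
  exact disjoint_ball_infDist

lemma differentiableOn_pdx_sub_pdy {Ω : Set ℂ} (ho : IsOpen Ω) {ω : ℂ → ℝ}
    (hω : HarmonicOnNhd ω Ω) :
    DifferentiableOn ℂ (fun z => (pdx ω z : ℂ) - I * (pdy ω z : ℂ)) Ω := by
  intro z hz
  obtain ⟨F, hF, h⟩ := hω.locallyReOn ho z hz
  refine DifferentiableAt.differentiableWithinAt ?_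
  refine hF.deriv.differentiableAt.congr_of_eventuallyEq ?_
  filter_upwards [hF.eventually_analyticAt, h.eventually_nhds] with y h1 h2
  exact pdx_sub_pdy_eq_deriv h1.differentiableAt h2

section SchwarzFunction

variable {Ω : Set ℂ} {q : Polynomial ℂ} {s : ℂ → ℂ}

lemma frontier_subset_eval_ne_zero (ho : IsOpen Ω) (hq : ∀ z, q.eval z = 0 → z ∈ Ω) :
    frontier Ω ⊆ {z | q.eval z ≠ 0} := fun z hz h0 => hz.2 (by
  rw [ho.interior_eq]; exact hq z h0)

lemma isOpen_eval_ne_zero (q : Polynomial ℂ) : IsOpen {z | q.eval z ≠ 0} :=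
  isOpen_ne_fun q.continuous continuous_const

lemma tendsto_schwarz_sub_conj (ho : IsOpen Ω) (hq : ∀ z, q.eval z = 0 → z ∈ Ω)
    (hsc : Continuous s) (hsf : ∀ z ∈ frontier Ω, s z = conj z * q.eval z) :
    Tendsto (fun z => s z / q.eval z - conj z) (innerBoundary Ω) (𝓝 0) := by
  refine tendsto_innerBoundary_zero (fun p hp => ?_) fun p hp => ?_
  · have h0 : q.eval p ≠ 0 := frontier_subset_eval_ne_zero ho hq hp
    have h1 := q.continuous.continuousAt (x := p)
    have h2 := hsc.continuousAt (x := p)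
    have h3 := continuous_conj.continuousAt (x := p)
    exact (h2.div h1 h0).sub h3
  · have h0 : q.eval p ≠ 0 := frontier_subset_eval_ne_zero ho hq hp
    rw [hsf p hp, mul_div_cancel_right₀ _ h0, sub_self]

lemma exists_norm_deriv_schwarz_le (ho : IsOpen Ω) (hb : Bornology.IsBounded Ω)
    (hq : ∀ z, q.eval z = 0 → z ∈ Ω) (hsc : Continuous s) (hsd : DifferentiableOn ℂ s Ω)
    (hsf : ∀ z ∈ frontier Ω, s z = conj z * q.eval z) {ρ : ℝ} (hρ : 0 < ρ) :
    ∃ K δ : ℝ, 0 < δ ∧ ∀ p ∈ frontier Ω, ∀ T, TangentBalls Ω ρ p T → ∀ z ∈ Ω, 0 < ‖z - p‖ →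
      ‖z - p‖ < δ → ball z ‖z - p‖ ⊆ Ω →
      q.eval z ≠ 0 ∧ ‖(deriv s z * q.eval z - s z * q.derivative.eval z) / q.eval z ^ 2 -
        conj T ^ 2‖ ^ 4 ≤ K * ‖z - p‖ ^ 2 := by
  have hfc : IsCompact (frontier Ω) := hb.isCompact_closure.of_isClosed_subset isClosed_frontier
    frontier_subset_closure
  obtain ⟨r₁, hr₁, hsub⟩ := hfc.exists_cthickening_subset_open (isOpen_eval_ne_zero q)
    (frontier_subset_eval_ne_zero ho hq)
  set r₀ := min r₁ (ρ / 4) with hr₀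
  have hr₀pos : 0 < r₀ := lt_min hr₁ (by positivity)
  have hcomp : IsCompact (cthickening r₁ (frontier Ω)) := hfc.cthickening
  have hq0 : ∀ z ∈ cthickening r₁ (frontier Ω), q.eval z ≠ 0 := fun z hz => hsub hz
  have hcont : ContinuousOn (fun z => s z / q.eval z) (cthickening r₁ (frontier Ω)) :=
    hsc.continuousOn.div q.continuous.continuousOn hq0
  obtain ⟨B, hB⟩ := hcomp.exists_bound_of_continuousOn
    (hcont.sub (continuous_conj.continuousOn (s := cthickening r₁ (frontier Ω))))
  have hsubB : ∀ p ∈ frontier Ω, closedBall p r₀ ⊆ cthickening r₁ (frontier Ω) := fun p hp =>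
    (closedBall_subset_closedBall (min_le_left _ _)).trans
      (closedBall_subset_cthickening hp r₁)
  refine ⟨16 * 2304 ^ 3 * (B + 3 * r₀) / ρ ^ 3, r₀ / 48, by positivity,
    fun p hp T hT z hz hpos hlt hball => ?_⟩
  have hzc : z ∈ cthickening r₁ (frontier Ω) := hsubB p hp (by
    rw [mem_closedBall, dist_eq_norm]; linarith)
  refine ⟨hq0 z hzc, ?_⟩
  have hd : deriv (fun z => s z / q.eval z) z =
      (deriv s z * q.eval z - s z * q.derivative.eval z) / q.eval z ^ 2 := by
    have := (hsd.differentiableAt (ho.mem_nhds hz)).hasDerivAt.fun_div (q.hasDerivAt z) (hq0 z hzc)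
    exact this.deriv
  rw [← hd]
  refine hT.norm_deriv_sub_pow_le ho (S := fun z => s z / q.eval z) (r₀ := r₀) (B := B) ?_ ?_ ?_
    (fun y hy => hB y (hsubB p hp hy.2)) ?_ hpos (by linarith) le_rfl hball
  · linarith [min_le_right r₁ (ρ / 4)]
  · refine (hsd.mono inter_subset_left).div q.differentiable.differentiableOn fun y hy => ?_
    exact hq0 y (hsubB p hp (ball_subset_closedBall hy.2))
  · exact hcont.mono fun y hy => hsubB p hp hy.2
  · intro y hy
    rw [hsf y hy.1, mul_div_cancel_right₀ _ (hq0 y (hsubB p hp hy.2))]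

lemma norm_conj_add_div_le {u T σ : ℂ} {η κ : ℝ} (hT : ‖T‖ = 1) (hη : |(u * T).re| ≤ η)
    (hκ : ‖σ - conj T ^ 2‖ ≤ κ) (hκ2 : κ ≤ 1 / 2) :
    σ ≠ 0 ∧ ‖conj u + u / σ‖ ≤ 2 * η + 2 * ‖u‖ * κ := by
  have hTT := conj_mul_self_of_norm_eq_one hT
  have h1 : 1 / 2 ≤ ‖σ‖ := by
    have h2 : ‖conj T ^ 2‖ = 1 := by rw [norm_pow, RCLike.norm_conj, hT, one_pow]
    have h3 := norm_sub_norm_le (conj T ^ 2) σ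
    rw [norm_sub_rev] at h3
    linarith
  have hσ : σ ≠ 0 := norm_pos_iff.1 (by linarith)
  refine ⟨hσ, ?_⟩
  have h4 : conj u = 2 * ((u * T).re : ℂ) * T - u * T ^ 2 := by
    have h5 : (2 * ((u * T).re : ℂ)) = u * T + conj (u * T) := by
      rw [Complex.add_conj, ofReal_mul, ofReal_ofNat]
    rw [h5, map_mul]
    linear_combination -(conj u) * hTT
  have h6 : conj u + u / σ = 2 * ((u * T).re : ℂ) * T - u * (T ^ 2 * (σ - conj T ^ 2) / σ) := by
    rw [h4]
    field_simp
    linear_combination (-u * (1 + conj T * T)) * hTT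
  rw [h6]
  refine (norm_sub_le _ _).trans (add_le_add ?_ ?_)
  · rw [norm_mul, norm_mul, hT, mul_one, Complex.norm_real, Real.norm_eq_abs]
    simpa using hη
  · rw [norm_mul, norm_div, norm_mul, norm_pow, hT, one_pow, one_mul]
    have : ‖σ - conj T ^ 2‖ / ‖σ‖ ≤ 2 * κ := by
      rw [div_le_iff₀ (by linarith)]
      nlinarith [norm_nonneg (σ - conj T ^ 2)]
    calc _ ≤ ‖u‖ * (2 * κ) := by gcongr
      _ = _ := by ring

lemma tendsto_conj_add_div_innerBoundary (ho : IsOpen Ω) (hb : Bornology.IsBounded Ω)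
    (hne : (frontier Ω).Nonempty)
    (hq : ∀ z, q.eval z = 0 → z ∈ Ω) (hsc : Continuous s) (hsd : DifferentiableOn ℂ s Ω)
    (hsf : ∀ z ∈ frontier Ω, s z = conj z * q.eval z) {ρ : ℝ} (hρ : 0 < ρ)
    (hT : ∀ p ∈ frontier Ω, ∃ T, TangentBalls Ω ρ p T) {u : ℂ → ℂ} {C δ : ℝ} (hδ : 0 < δ)
    (hu : ∀ p ∈ frontier Ω, ∀ T, TangentBalls Ω ρ p T → ∀ z ∈ Ω, ‖z - p‖ < δ →
      ball z ‖z - p‖ ⊆ Ω → ‖u z‖ ≤ C ∧ |(u z * T).re| ≤ C * √‖z - p‖) :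
    (∀ᶠ z in innerBoundary Ω, q.eval z ≠ 0 ∧
      deriv s z * q.eval z - s z * q.derivative.eval z ≠ 0 ∧ ‖u z‖ ≤ C) ∧
    Tendsto (fun z => conj (u z) +
      u z * q.eval z ^ 2 / (deriv s z * q.eval z - s z * q.derivative.eval z))
      (innerBoundary Ω) (𝓝 0) := by
  obtain ⟨K, δ', hδ', H⟩ := exists_norm_deriv_schwarz_le ho hb hq hsc hsd hsf hρ
  have hlim : ∀ g : ℝ → ℝ, Continuous g → g 0 = 0 →
      Tendsto (fun z => g (infDist z (frontier Ω))) (innerBoundary Ω) (𝓝 0) := by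
    intro g hg h0
    have := (hg.tendsto 0).comp (tendsto_infDist_innerBoundary Ω)
    rwa [h0] at this
  have hκ := hlim (fun d => √√(K * d ^ 2)) (by fun_prop) (by simp)
  have main : ∀ᶠ z in innerBoundary Ω, (q.eval z ≠ 0 ∧
      deriv s z * q.eval z - s z * q.derivative.eval z ≠ 0 ∧ ‖u z‖ ≤ C) ∧
      ‖conj (u z) + u z * q.eval z ^ 2 / (deriv s z * q.eval z - s z * q.derivative.eval z)‖ ≤
      2 * (C * √(infDist z (frontier Ω))) + 2 * C * √√(K * infDist z (frontier Ω) ^ 2) := by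
    filter_upwards [eventually_mem_innerBoundary Ω, hκ.eventually_lt_const one_half_pos,
      (tendsto_infDist_innerBoundary Ω).eventually_lt_const hδ,
      (tendsto_infDist_innerBoundary Ω).eventually_lt_const hδ'] with z hz h1 h2 h3
    obtain ⟨p, hp, hd, hpos, hball⟩ := exists_nearest_frontier ho hne hz
    obtain ⟨T, hTp⟩ := hT p hp
    rw [← hd] at h1 h2 h3 ⊢
    obtain ⟨hq0, h4⟩ := H p hp T hTp z hz hpos h3 hball
    obtain ⟨h5, h6⟩ := hu p hp T hTp z hz h2 hball
    set v := deriv s z * q.eval z - s z * q.derivative.eval z with hv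
    have h7 : ‖v / q.eval z ^ 2 - conj T ^ 2‖ ≤ √√(K * ‖z - p‖ ^ 2) := by
      have h8 := Real.sqrt_le_sqrt (Real.sqrt_le_sqrt h4)
      have h9 : ∀ x : ℝ, 0 ≤ x → √√(x ^ 4) = x := by
        intro x hx
        rw [show x ^ 4 = (x ^ 2) ^ 2 by ring, Real.sqrt_sq (by positivity), Real.sqrt_sq hx]
      rwa [h9 _ (norm_nonneg _)] at h8
    obtain ⟨h10, h11⟩ := norm_conj_add_div_le hTp.norm_eq_one h6 h7 h1.le
    have hv0 : v ≠ 0 := fun h0 => h10 (by rw [h0, zero_div])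
    refine ⟨⟨hq0, hv0, h5⟩, ?_⟩
    have h12 : u z * q.eval z ^ 2 / v = u z / (v / q.eval z ^ 2) := by field_simp
    rw [h12]
    refine h11.trans ?_
    gcongr
  refine ⟨main.mono fun z hz => hz.1, ?_⟩
  refine squeeze_zero_norm' (main.mono fun z hz => hz.2) ?_
  exact hlim (fun d => 2 * (C * √d) + 2 * C * √√(K * d ^ 2)) (by fun_prop) (by simp)

end SchwarzFunction

end

section

open InnerProductSpace Topology Filter

lemma exists_eq_const_of_tendsto_re_innerBoundary {Ω : Set ℂ} (ho : IsOpen Ω)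
    (hcon : IsConnected Ω) (hb : Bornology.IsBounded Ω) {f : ℂ → ℂ} (hf : DifferentiableOn ℂ f Ω)
    (h : Tendsto (fun z => (f z).re) (innerBoundary Ω) (𝓝 0)) : ∃ c, ∀ z ∈ Ω, f z = c := by
  classical
  refine AnalyticOnNhd.eq_const_of_re_eq_const (c₀ := 0) (hf.analyticOnNhd ho) ?_ ho hcon
  set U : ℂ → ℝ := fun z => if z ∈ Ω then (f z).re else 0 with hU
  have hloc : LocallyReOn U Ω := by
    intro z hz
    refine ⟨f, hf.analyticAt (ho.mem_nhds hz), ?_⟩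
    filter_upwards [ho.mem_nhds hz] with y hy
    exact if_pos hy
  have hfr : ∀ z ∈ frontier Ω, U z = 0 := fun z hz =>
    if_neg fun h' => hz.2 (by rwa [ho.interior_eq])
  have hc : ContinuousOn U (closure Ω) := by
    intro z hz
    by_cases hzΩ : z ∈ Ω
    · obtain ⟨F, hF, hE⟩ := hloc z hzΩ
      exact ((continuous_re.continuousAt.comp hF.continuousAt).congr hE.symm).continuousWithinAt
    · have hzf : z ∈ frontier Ω := ⟨hz, by rwa [ho.interior_eq]⟩
      rw [ContinuousWithinAt, hfr z hzf]
      have h1 := h.mono_left (nhdsWithin_le_innerBoundary hzf)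
      rw [Metric.tendsto_nhds] at h1 ⊢
      intro ε hε
      filter_upwards [nhdsWithin_le_nhds (eventually_nhdsWithin_iff.1 (h1 ε hε))] with y hy
      by_cases hyΩ : y ∈ Ω
      · rw [hU]
        simpa only [if_pos hyΩ] using hy hyΩ
      · rw [hU]
        simpa only [if_neg hyΩ, dist_self] using hε
  intro z hz
  have h1 := hloc.le_of_frontier_le ho hb hc (fun y hy => (hfr y hy).le) z hz
  have h2 := hloc.neg.le_of_frontier_le (m := 0) ho hb hc.neg
    (fun y hy => by rw [hfr y hy, neg_zero]) z hz
  have h3 : U z = (f z).re := if_pos hz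
  rw [h3] at h1 h2
  linarith

lemma finite_zeros_of_eventually_innerBoundary {Ω : Set ℂ} (ho : IsOpen Ω)
    (hcon : IsConnected Ω) (hb : Bornology.IsBounded Ω) (hne : (frontier Ω).Nonempty)
    {f : ℂ → ℂ} (hf : DifferentiableOn ℂ f Ω) (h : ∀ᶠ z in innerBoundary Ω, f z ≠ 0) :
    {z ∈ Ω | f z = 0}.Finite ∧ ∀ z ∈ Ω, ¬∀ᶠ y in 𝓝 z, f y = 0 := by
  have hcomp : IsCompact {z ∈ Ω | f z = 0} := by
    refine hb.isCompact_closure.of_isClosed_subset ?_ fun z hz => subset_closure hz.1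
    refine isClosed_of_closure_subset fun z hz => ?_
    have hzc : z ∈ closure Ω := closure_mono (fun y hy => hy.1) hz
    rw [mem_closure_iff_frequently] at hz
    by_cases hzΩ : z ∈ Ω
    · refine ⟨hzΩ, ?_⟩
      by_contra h0
      have := (hf.continuousOn.continuousAt (ho.mem_nhds hzΩ)).eventually_ne h0
      exact hz (this.mono fun y hy hy' => hy hy'.2)
    · have hzf : z ∈ frontier Ω := ⟨hzc, by rwa [ho.interior_eq]⟩
      have h1 := eventually_nhdsWithin_iff.1 (h.filter_mono (nhdsWithin_le_innerBoundary hzf))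
      exact (hz (h1.mono fun y hy hy' => hy hy'.1 hy'.2)).elim
  have han := hf.analyticOnNhd ho
  have hnz : ¬EqOn f 0 Ω := by
    intro h0
    obtain ⟨p, hp⟩ := hne
    have h1 := h.filter_mono (nhdsWithin_le_innerBoundary hp)
    have : (𝓝[Ω] p).NeBot := mem_closure_iff_nhdsWithin_neBot.1 hp.1
    obtain ⟨y, hy, hyΩ⟩ := (h1.and self_mem_nhdsWithin).exists
    exact hy (h0 hyΩ)
  refine ⟨?_, fun z hz h0 => hnz (han.eqOn_zero_of_preconnected_of_eventuallyEq_zero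
    hcon.isPreconnected hz h0)⟩
  by_contra hinf
  obtain ⟨a, ha, hacc⟩ := hcomp.isCountablyCompact.exists_accPt_of_infinite
    subset_rfl hinf
  refine hnz (han.eqOn_zero_of_preconnected_of_frequently_eq_zero hcon.isPreconnected ha.1 ?_)
  exact (accPt_iff_frequently_nhdsNE.1 hacc).mono fun y hy => hy.2

/-- The product of the linear factors with the given roots. -/
def rootProd (L : List ℂ) (z : ℂ) : ℂ := (L.map fun b => z - b).prod

@[simp] lemma rootProd_nil (z : ℂ) : rootProd [] z = 1 := rfl

@[simp] lemma rootProd_cons (b : ℂ) (L : List ℂ) (z : ℂ) :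
    rootProd (b :: L) z = (z - b) * rootProd L z := by simp [rootProd]

lemma rootProd_append (L M : List ℂ) (z : ℂ) :
    rootProd (L ++ M) z = rootProd L z * rootProd M z := by simp [rootProd]

lemma continuous_rootProd (L : List ℂ) : Continuous (rootProd L) := by
  induction L with
  | nil => exact continuous_const
  | cons b L ih =>
    rw [show rootProd (b :: L) = _ from funext (rootProd_cons b L)]
    fun_prop

lemma exists_of_rootProd_eq_zero {L : List ℂ} {z : ℂ} (h : rootProd L z = 0) : z ∈ L := by
  induction L with
  | nil => simp at h
  | cons b L ih =>
    rw [rootProd_cons, mul_eq_zero] at h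
    rcases h with h | h
    · rw [sub_eq_zero.1 h]; exact List.mem_cons_self
    · exact List.mem_cons_of_mem _ (ih h)

lemma rootProd_replicate (b : ℂ) (n : ℕ) (z : ℂ) :
    rootProd (List.replicate n b) z = (z - b) ^ n := by simp [rootProd]

lemma exists_list_pow {L : List ℂ} {Ω : Set ℂ} (h : ∀ b ∈ L, b ∈ Ω) (d : ℕ) :
    ∃ M : List ℂ, (∀ b ∈ M, b ∈ Ω) ∧ M.length = d * L.length ∧
      ∀ z, rootProd M z = rootProd L z ^ d := by
  induction d with
  | zero => exact ⟨[], by simp, by simp, by simp⟩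
  | succ d ih =>
    obtain ⟨M, h1, h2, h3⟩ := ih
    refine ⟨M ++ L, ?_, ?_, fun z => ?_⟩
    · intro b hb
      exact (List.mem_append.1 hb).elim (h1 b) (h b)
    · rw [List.length_append, h2]; ring
    · rw [rootProd_append, h3, pow_succ]

lemma exists_rootProd_eq_mul_of_finite {Ω : Set ℂ} (ho : IsOpen Ω) (Z : Finset ℂ) :
    ∀ f : ℂ → ℂ, DifferentiableOn ℂ f Ω → (∀ z ∈ Ω, f z = 0 ↔ z ∈ Z) → (∀ z ∈ Z, z ∈ Ω) →
      (∀ z ∈ Ω, ¬∀ᶠ y in 𝓝 z, f y = 0) →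
      ∃ (L : List ℂ) (e : ℂ → ℂ), (∀ b ∈ L, b ∈ Ω) ∧ DifferentiableOn ℂ e Ω ∧
        ∀ z ∈ Ω, rootProd L z = f z * e z := by
  classical
  induction Z using Finset.induction_on with
  | empty =>
    intro f hf hz _ _
    have h0 : ∀ z ∈ Ω, f z ≠ 0 := fun z h h' => by simpa using (hz z h).1 h'
    exact ⟨[], fun z => (f z)⁻¹, by simp, hf.inv h0, fun z h => by simp [h0 z h]⟩
  | insert a Z ha ih =>
    intro f hf hz hZ hne
    have haΩ : a ∈ Ω := hZ a (Finset.mem_insert_self _ _)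
    obtain ⟨n, g₀, hg₀, hg₀a, hfg⟩ := (hf.analyticAt (ho.mem_nhds haΩ)
      ).exists_eventuallyEq_pow_smul_nonzero_iff.2 (hne a haΩ)
    set g : ℂ → ℂ := Function.update (fun z => f z / (z - a) ^ n) a (g₀ a) with hg
    have hga : g a = g₀ a := Function.update_self _ _ _
    have hgne : ∀ z, z ≠ a → g z = f z / (z - a) ^ n := fun z h => Function.update_of_ne h _ _
    have hgg₀ : g =ᶠ[𝓝 a] g₀ := by
      filter_upwards [hfg] with z h
      by_cases hza : z = a
      · rw [hza, hga]
      · rw [hgne z hza, h, smul_eq_mul, mul_div_cancel_left₀]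
        exact pow_ne_zero _ (sub_ne_zero.2 hza)
    have hfgΩ : ∀ z, f z = (z - a) ^ n * g z := by
      intro z
      by_cases hza : z = a
      · rw [hza, hga]
        simpa using hfg.self_of_nhds
      · rw [hgne z hza, mul_div_cancel₀]
        exact pow_ne_zero _ (sub_ne_zero.2 hza)
    have hgd : DifferentiableOn ℂ g Ω := by
      intro z hzΩ
      refine DifferentiableAt.differentiableWithinAt ?_
      by_cases hza : z = a
      · rw [hza]
        exact hg₀.differentiableAt.congr_of_eventuallyEq hgg₀
      · have : g =ᶠ[𝓝 z] fun z => f z / (z - a) ^ n := by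
          filter_upwards [isOpen_ne.mem_nhds hza] with y hy
          exact hgne y hy
        refine DifferentiableAt.congr_of_eventuallyEq ?_ this
        have h1 := hf.differentiableAt (ho.mem_nhds hzΩ)
        have h2 : (z - a) ^ n ≠ 0 := pow_ne_zero _ (sub_ne_zero.2 hza)
        fun_prop (disch := assumption)
    have hgz : ∀ z ∈ Ω, g z = 0 ↔ z ∈ Z := by
      intro z hzΩ
      by_cases hza : z = a
      · rw [hza, hga]
        exact iff_of_false hg₀a ha
      · have h1 := hz z hzΩ
        rw [Finset.mem_insert, or_iff_right hza, hfgΩ z, mul_eq_zero,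
          or_iff_right (pow_ne_zero _ (sub_ne_zero.2 hza))] at h1
        exact h1
    obtain ⟨L, e, hL, he, hLe⟩ := ih g hgd hgz
      (fun z h => hZ z (Finset.mem_insert_of_mem h)) (fun z hzΩ h => hne z hzΩ (h.mono fun y hy => by
        rw [hfgΩ, hy, mul_zero]))
    refine ⟨List.replicate n a ++ L, e, fun b hb => ?_, he, fun z hzΩ => ?_⟩
    · rcases List.mem_append.1 hb with h | h
      · rw [(List.mem_replicate.1 h).2]; exact haΩ
      · exact hL b h
    · rw [rootProd_append, rootProd_replicate, hLe z hzΩ, hfgΩ z]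
      ring

/-- A holomorphic function that does not vanish near the boundary divides a product of linear
factors. -/
lemma exists_rootProd_eq_mul {Ω : Set ℂ} (ho : IsOpen Ω)
    (hcon : IsConnected Ω) (hb : Bornology.IsBounded Ω) (hne : (frontier Ω).Nonempty)
    {f : ℂ → ℂ} (hf : DifferentiableOn ℂ f Ω) (h : ∀ᶠ z in innerBoundary Ω, f z ≠ 0) :
    ∃ (L : List ℂ) (e : ℂ → ℂ), (∀ b ∈ L, b ∈ Ω) ∧ DifferentiableOn ℂ e Ω ∧
      ∀ z ∈ Ω, rootProd L z = f z * e z := by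
  obtain ⟨hfin, hnz⟩ := finite_zeros_of_eventually_innerBoundary ho hcon hb hne hf h
  refine exists_rootProd_eq_mul_of_finite ho hfin.toFinset f hf (fun z hz => ?_) (fun z hz => ?_) hnz
  · simp [hz]
  · exact (hfin.mem_toFinset.1 hz).1

/-- Division with remainder by a product of linear factors (Newton interpolation). -/
lemma exists_eq_sum_add_rootProd_mul {Ω : Set ℂ} (ho : IsOpen Ω) (L : List ℂ)
    (hL : ∀ b ∈ L, b ∈ Ω) :
    ∃ E : Fin L.length → ℂ → ℂ, ∀ f : ℂ → ℂ, DifferentiableOn ℂ f Ω →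
      ∃ (a : Fin L.length → ℂ) (g : ℂ → ℂ), DifferentiableOn ℂ g Ω ∧
        ∀ z, f z = ∑ i, a i * E i z + rootProd L z * g z := by
  induction L with
  | nil => exact ⟨fun _ _ => 0, fun f hf => ⟨fun _ => 0, f, hf, fun z => by simp⟩⟩
  | cons b L ih =>
    obtain ⟨E, hE⟩ := ih fun c hc => hL c (List.mem_cons_of_mem _ hc)
    have hbΩ := ho.mem_nhds (hL b List.mem_cons_self)
    refine ⟨Fin.cons (fun _ => 1) fun i z => (z - b) * E i z, fun f hf => ?_⟩
    obtain ⟨a, g, hg, h⟩ := hE (dslope f b) ((Complex.differentiableOn_dslope hbΩ).2 hf)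
    refine ⟨Fin.cons (f b) a, g, hg, fun z => ?_⟩
    have h1 := sub_smul_dslope f b z
    rw [smul_eq_mul, h z] at h1
    have h2 : ∑ i, (Fin.cons (f b) a : Fin (L.length + 1) → ℂ) i *
        (Fin.cons (fun _ => 1) (fun i z => (z - b) * E i z) : Fin (L.length + 1) → ℂ → ℂ) i z =
        f b + (z - b) * ∑ i, a i * E i z := by
      rw [Fin.sum_univ_succ, Finset.mul_sum]
      simp only [Fin.cons_zero, Fin.cons_succ, mul_one]
      congr 1
      exact Finset.sum_congr rfl fun i _ => by ring
    refine Eq.trans ?_ (congrArg (· + rootProd (b :: L) z * g z) h2.symm)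
    rw [rootProd_cons]
    linear_combination -h1

lemma exists_ne_zero_sum_eq_rootProd_mul {Ω : Set ℂ} (ho : IsOpen Ω) {L : List ℂ}
    (hL : ∀ b ∈ L, b ∈ Ω) {ι : Type*} [Fintype ι] (f : ι → ℂ → ℂ)
    (hf : ∀ i, DifferentiableOn ℂ (f i) Ω) (w : ι → ℂ) (hcard : L.length + 1 < Fintype.card ι) :
    ∃ (α : ι → ℂ) (g : ℂ → ℂ), (∃ i, α i ≠ 0) ∧ DifferentiableOn ℂ g Ω ∧
      ∑ i, α i * w i = 0 ∧ ∀ z, ∑ i, α i * f i z = rootProd L z * g z := by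
  obtain ⟨E, hE⟩ := exists_eq_sum_add_rootProd_mul ho L hL
  choose a g hg h using fun i => hE (f i) (hf i)
  have hdep : ¬LinearIndependent ℂ fun i => (a i, w i) := by
    intro hli
    have := hli.fintype_card_le_finrank
    rw [Module.finrank_prod, Module.finrank_fin_fun, Module.finrank_self] at this
    omega
  obtain ⟨α, hsum, i, hi⟩ := Fintype.not_linearIndependent_iff.1 hdep
  have hsum1 := congrArg Prod.fst hsum
  have hsum2 := congrArg Prod.snd hsum
  rw [Prod.fst_sum] at hsum1
  rw [Prod.snd_sum] at hsum2
  refine ⟨α, fun z => ∑ i, α i * g i z, ⟨i, hi⟩, ?_, by simpa using hsum2, fun z => ?_⟩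
  · exact DifferentiableOn.fun_sum fun i _ => (hg i).const_mul _
  · have h1 : ∀ k, ∑ i, α i * a i k = 0 := fun k => by simpa using congrFun hsum1 k
    calc ∑ i, α i * f i z
        = ∑ i, (∑ k, α i * a i k * E k z) + rootProd L z * ∑ i, α i * g i z := by
          rw [Finset.mul_sum, ← Finset.sum_add_distrib]
          refine Finset.sum_congr rfl fun i _ => ?_
          rw [h i z, mul_add, Finset.mul_sum]
          congr 1
          · exact Finset.sum_congr rfl fun k _ => by ring
          · ring
      _ = rootProd L z * ∑ i, α i * g i z := by
          rw [Finset.sum_comm]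
          simp only [← Finset.sum_mul, h1, zero_mul, Finset.sum_const_zero, zero_add]

end

section

open InnerProductSpace Topology Filter

section

open Asymptotics

variable {l : Filter ℂ} {a b A B : ℂ → ℂ}

lemma isLittleO_one_mul_sub_mul (ha : a =O[l] fun _ => (1 : ℝ)) (hb : b =O[l] fun _ => (1 : ℝ))
    (hA : (fun z => A z - a z) =o[l] fun _ => (1 : ℝ))
    (hB : (fun z => B z - b z) =o[l] fun _ => (1 : ℝ)) :
    (fun z => A z * B z - a z * b z) =o[l] fun _ => (1 : ℝ) := by
  have h1 := hA.mul hB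
  have h2 := hA.mul_isBigO hb
  have h3 := ha.mul_isLittleO hB
  simp only [mul_one] at h1 h2 h3
  refine ((h1.add h2).add h3).congr_left fun z => ?_
  ring

lemma isLittleO_one_pow_sub_pow (ha : a =O[l] fun _ => (1 : ℝ))
    (hA : (fun z => A z - a z) =o[l] fun _ => (1 : ℝ)) (n : ℕ) :
    (fun z => A z ^ n - a z ^ n) =o[l] fun _ => (1 : ℝ) := by
  induction n with
  | zero =>
    simp only [pow_zero, sub_self]
    exact isLittleO_zero _ _
  | succ n ih =>
    simp only [pow_succ]
    exact isLittleO_one_mul_sub_mul (by simpa using ha.pow n) ha ih hA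

lemma isLittleO_one_sum_sub_sum (ha : a =O[l] fun _ => (1 : ℝ)) (hb : b =O[l] fun _ => (1 : ℝ))
    (hA : (fun z => A z - a z) =o[l] fun _ => (1 : ℝ))
    (hB : (fun z => B z - b z) =o[l] fun _ => (1 : ℝ)) {n : ℕ} (α : Fin n × Fin n → ℂ) :
    (fun z => ∑ i, α i * (A z ^ (i.1 : ℕ) * B z ^ (i.2 : ℕ)) -
      ∑ i, α i * (a z ^ (i.1 : ℕ) * b z ^ (i.2 : ℕ))) =o[l] fun _ => (1 : ℝ) := by
  have hpow : ∀ {f : ℂ → ℂ} (k : ℕ), (f =O[l] fun _ => (1 : ℝ)) →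
      (fun z => f z ^ k) =O[l] fun _ => (1 : ℝ) := fun k h => by simpa using h.pow k
  simp only [← Finset.sum_sub_distrib, ← mul_sub]
  refine IsLittleO.fun_sum (A := fun i z => α i * (A z ^ (i.1 : ℕ) * B z ^ (i.2 : ℕ) -
    a z ^ (i.1 : ℕ) * b z ^ (i.2 : ℕ))) fun i _ => IsLittleO.const_mul_left ?_ _
  exact isLittleO_one_mul_sub_mul (hpow i.1 ha) (hpow i.2 hb)
    (isLittleO_one_pow_sub_pow ha hA _) (isLittleO_one_pow_sub_pow hb hB _)

end

/-- The bivariate polynomial with given coefficients does not vanish unless its coefficients do. -/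
lemma exists_mvPolynomial_eval {n : ℕ} (α : Fin n × Fin n → ℂ) (hα : ∃ i, α i ≠ 0) :
    ∃ P : MvPolynomial (Fin 2) ℂ, P ≠ 0 ∧ ∀ x y : ℂ, MvPolynomial.eval ![x, y] P =
      ∑ i, α i * (x ^ (i.1 : ℕ) * y ^ (i.2 : ℕ)) := by
  classical
  let μ : Fin n × Fin n → (Fin 2 →₀ ℕ) := fun i =>
    Finsupp.single 0 (i.1 : ℕ) + Finsupp.single 1 (i.2 : ℕ)
  have hμ : Function.Injective μ := by
    intro i j h
    have h0 := DFunLike.congr_fun h 0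
    have h1 := DFunLike.congr_fun h 1
    simp [μ] at h0 h1
    exact Prod.ext (Fin.ext h0) (Fin.ext h1)
  refine ⟨∑ i, MvPolynomial.monomial (μ i) (α i), fun h => ?_, fun x y => ?_⟩
  · obtain ⟨k, hk⟩ := hα
    have := congrArg (MvPolynomial.coeff (μ k)) h
    simp only [MvPolynomial.coeff_sum, MvPolynomial.coeff_monomial, hμ.eq_iff,
      Finset.sum_ite_eq', Finset.mem_univ, if_true, MvPolynomial.coeff_zero] at this
    exact hk this
  · rw [map_sum]
    refine Finset.sum_congr rfl fun i _ => ?_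
    rw [MvPolynomial.eval_monomial, Finsupp.prod_fintype _ _ (by simp)]
    simp [μ, Fin.prod_univ_two]

/-- Two holomorphic functions that are asymptotically conjugate at the boundary are constant. -/
lemma exists_eq_const_of_tendsto_conj_sub {Ω : Set ℂ} (ho : IsOpen Ω)
    (hcon : IsConnected Ω) (hb : Bornology.IsBounded Ω) {f g : ℂ → ℂ}
    (hf : DifferentiableOn ℂ f Ω) (hg : DifferentiableOn ℂ g Ω)
    (h : Tendsto (fun z => g z - conj (f z)) (innerBoundary Ω) (𝓝 0)) :
    ∃ c, ∀ z ∈ Ω, f z = c := by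
  have hre := (continuous_re.tendsto 0).comp h
  have him := (continuous_im.tendsto 0).comp h
  obtain ⟨c₁, h₁⟩ := exists_eq_const_of_tendsto_re_innerBoundary ho hcon hb (hg.sub hf)
    (by simpa [Function.comp_def] using hre)
  obtain ⟨c₂, h₂⟩ := exists_eq_const_of_tendsto_re_innerBoundary ho hcon hb
    ((hg.add hf).const_mul (-I)) (by simpa [Function.comp_def] using him)
  refine ⟨(I * c₂ - c₁) / 2, fun z hz => ?_⟩
  rw [← h₁ z hz, ← h₂ z hz]
  simp only [Pi.sub_apply, Pi.add_apply]
  linear_combination ((g z + f z) / 2) * I_mul_I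

/-- A holomorphic function whose boundary conjugate is given by a meromorphic function on `Ω`,
in a domain where `conj z` also agrees with a meromorphic function on the boundary, is algebraic. -/
lemma exists_mvPolynomial_eval_eq_zero {Ω : Set ℂ} (ho : IsOpen Ω) (hcon : IsConnected Ω)
    (hb : Bornology.IsBounded Ω) (hne : (frontier Ω).Nonempty) {q s u v w : ℂ → ℂ}
    (hq : DifferentiableOn ℂ q Ω) (hs : DifferentiableOn ℂ s Ω) (hu : DifferentiableOn ℂ u Ω)
    (hv : DifferentiableOn ℂ v Ω) (hw : DifferentiableOn ℂ w Ω) {C : ℝ}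
    (hbd : ∀ᶠ z in innerBoundary Ω, q z ≠ 0 ∧ v z ≠ 0 ∧ ‖u z‖ ≤ C)
    (hconj : Tendsto (fun z => s z / q z - conj z) (innerBoundary Ω) (𝓝 0))
    (hlim : Tendsto (fun z => w z / v z - conj (u z)) (innerBoundary Ω) (𝓝 0)) :
    ∃ P : MvPolynomial (Fin 2) ℂ, P ≠ 0 ∧ ∀ z ∈ Ω, MvPolynomial.eval ![z, u z] P = 0 := by
  obtain ⟨z₀, hz₀⟩ := hcon.nonempty
  obtain ⟨L, e, hL, he, hLe⟩ := exists_rootProd_eq_mul ho hcon hb hne (hq.mul hv)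
    (hbd.mono fun z hz => mul_ne_zero hz.1 hz.2.1)
  set d := L.length + 1 with hd
  obtain ⟨M, hM, hMlen, hMpow⟩ := exists_list_pow hL d
  have hM0 : ∀ᶠ z in innerBoundary Ω, rootProd M z ≠ 0 := by
    refine eventually_innerBoundary_of_isOpen (U := {z | rootProd M z ≠ 0})
      (isOpen_ne_fun (continuous_rootProd M) continuous_const) fun z hz h0 => ?_
    refine hz.2 ?_
    rw [ho.interior_eq]
    exact hM z (exists_of_rootProd_eq_zero h0)
  obtain ⟨α, G, hα, hG, hα0, hαG⟩ := exists_ne_zero_sum_eq_rootProd_mul ho hM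
    (ι := Fin (d + 1) × Fin (d + 1))
    (fun i z => s z ^ (i.1 : ℕ) * q z ^ (d - i.1) * (w z ^ (i.2 : ℕ) * v z ^ (d - i.2)) * e z ^ d)
    (fun i => by fun_prop)
    (fun i => conj z₀ ^ (i.1 : ℕ) * conj (u z₀) ^ (i.2 : ℕ)) (by
      rw [hMlen, Fintype.card_prod, Fintype.card_fin]
      nlinarith [hd])
  obtain ⟨P, hP, hPe⟩ := exists_mvPolynomial_eval (fun i => conj (α i))
    (hα.imp fun i hi => (map_ne_zero _).2 hi)
  refine ⟨P, hP, ?_⟩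
  set h : ℂ → ℂ := fun z => ∑ i, conj (α i) * (z ^ (i.1 : ℕ) * u z ^ (i.2 : ℕ)) with hh
  have hhd : DifferentiableOn ℂ h Ω := by
    refine DifferentiableOn.fun_sum fun i _ => ?_
    fun_prop
  have hhc : ∀ z, conj (h z) = ∑ i, α i * (conj z ^ (i.1 : ℕ) * conj (u z) ^ (i.2 : ℕ)) :=
    fun z => by simp [hh]
  have hGe : ∀ᶠ z in innerBoundary Ω,
      ∑ i, α i * ((s z / q z) ^ (i.1 : ℕ) * (w z / v z) ^ (i.2 : ℕ)) = G z := by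
    filter_upwards [hbd, hM0, eventually_mem_innerBoundary Ω] with z hz hMz hzΩ
    refine mul_left_cancel₀ hMz ?_
    rw [← hαG z, Finset.mul_sum]
    refine Finset.sum_congr rfl fun i _ => ?_
    rw [hMpow, hLe z hzΩ]
    have h1 : (q z) ^ d = q z ^ (i.1 : ℕ) * q z ^ (d - i.1) := by
      rw [← pow_add]; congr 1; omega
    have h2 : (v z) ^ d = v z ^ (i.2 : ℕ) * v z ^ (d - i.2) := by
      rw [← pow_add]; congr 1; omega
    have h3 := pow_ne_zero (i.1 : ℕ) hz.1
    have h4 := pow_ne_zero (i.2 : ℕ) hz.2.1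
    simp only [Pi.mul_apply]
    rw [mul_pow, mul_pow, h1, h2, div_pow, div_pow]
    field_simp
  have hz1 : (fun z : ℂ => conj z) =O[innerBoundary Ω] fun _ => (1 : ℝ) := by
    obtain ⟨R, hR⟩ := hb.exists_norm_le
    refine Asymptotics.IsBigO.of_bound R ?_
    filter_upwards [eventually_mem_innerBoundary Ω] with z hz
    simpa using hR z hz
  have hu1 : (fun z : ℂ => conj (u z)) =O[innerBoundary Ω] fun _ => (1 : ℝ) := by
    refine Asymptotics.IsBigO.of_bound C ?_
    filter_upwards [hbd] with z hz
    simpa using hz.2.2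
  have hdiff := (Asymptotics.isLittleO_one_iff ℝ).1 (isLittleO_one_sum_sub_sum hz1 hu1
    ((Asymptotics.isLittleO_one_iff ℝ).2 hconj) ((Asymptotics.isLittleO_one_iff ℝ).2 hlim) α)
  obtain ⟨c, hc⟩ := exists_eq_const_of_tendsto_conj_sub ho hcon hb hhd hG
    (hdiff.congr' (hGe.mono fun z hz => by simp only [hz, hhc z]))
  intro z hz
  have h0 : h z₀ = 0 := by
    rw [← map_eq_zero (starRingEnd ℂ), hhc, hα0]
  rw [hPe, ← h0, hc z₀ hz₀]
  exact hc z hz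

end

/-- for a smoothly bounded quadrature domain of finite area, the function
`F' = ∂ω/∂x − i ∂ω/∂y` attached to the harmonic measure of a boundary component is
algebraic. -/
theorem stmt_7 (Ω : Set ℂ) (hΩ : IsFinConnDomain Ω) (hA : volume Ω < ⊤)
    (hsm : HasSmoothBoundary Ω) (hq : IsQuadratureDomain Ω)
    (γ : Set ℂ) (hγ : ∃ x ∈ frontier Ω, γ = connectedComponentIn (frontier Ω) x)
    (ω : ℂ → ℝ)
    (hωc : ContinuousOn ω (closure Ω))
    (hωs : ContDiffOn ℝ 2 ω Ω)
    (hharm : ∀ z ∈ Ω, pdx (pdx ω) z + pdy (pdy ω) z = 0)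
    (hω1 : ∀ z ∈ γ, ω z = 1)
    (hω0 : ∀ z ∈ frontier Ω \ γ, ω z = 0) :
    ∃ P : MvPolynomial (Fin 2) ℂ, P ≠ 0 ∧
      ∀ z ∈ Ω,
        MvPolynomial.eval ![z, (pdx ω z : ℂ) - Complex.I * (pdy ω z : ℂ)] P = 0 := by
  have ho := hΩ.1
  have hcon := hΩ.2.1
  have hb := hsm.1
  have hne : (frontier Ω).Nonempty := hγ.imp fun x hx => hx.1
  have hfr : ∀ z ∈ frontier Ω, ω z = 0 ∨ ω z = 1 := fun z hz =>
    (em (z ∈ γ)).elim (fun h => Or.inr (hω1 z h)) fun h => Or.inl (hω0 z ⟨hz, h⟩)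
  have hω := harmonicOnNhd_of_pdx_pdy ho hωs hharm
  obtain ⟨ρ, hρ, hT⟩ := exists_tangentBalls ho hcon.isPreconnected hsm
  obtain ⟨C, δ, hδ, hgrad⟩ := exists_gradient_bounds ho hb hρ hT hω hωc hfr
  obtain ⟨q, s, -, hq0, hsc, hsd, hsf⟩ := exists_schwarz_function ho hA hb hq
    (volume_frontier_eq_zero_of_hasSmoothBoundary hsm)
    fun p hp => (hT p hp).elim fun T h => h.mem_closure_compl hρ
  obtain ⟨hbd, hlim⟩ := tendsto_conj_add_div_innerBoundary ho hb hne hq0 hsc hsd hsf hρ hT hδ hgrad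
  have hu := differentiableOn_pdx_sub_pdy ho hω
  have hqd : Differentiable ℂ fun z => q.eval z := q.differentiable
  have hqd' : Differentiable ℂ fun z => q.derivative.eval z := q.derivative.differentiable
  have hs' := hsd.deriv ho
  refine exists_mvPolynomial_eval_eq_zero ho hcon hb hne hqd.differentiableOn hsd hu
    (v := fun z => deriv s z * q.eval z - s z * q.derivative.eval z)
    (w := fun z => -(((pdx ω z : ℂ) - Complex.I * (pdy ω z : ℂ)) * q.eval z ^ 2))
    ((hs'.mul hqd.differentiableOn).sub (hsd.mul hqd'.differentiableOn))
    (hu.mul (hqd.pow 2).differentiableOn).neg hbd (tendsto_schwarz_sub_conj ho hq0 hsc hsf) ?_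
  have := hlim.neg
  rw [neg_zero] at this
  refine this.congr fun z => ?_
  rw [neg_div]
  ring
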